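/- arXiv:2301.05001 — 7 statements merged into one kernel-verified Lean document; each statement's English description precedes it below -/
import Mathlib

section
/- Let B ⊆ C be reduced commutative Noetherian rings with dim(B) = dim(C) = d ≥ 1, and let x ∈ B be a non-zero divisor in C such that B_x = C_x. Let P be a finitely generated projective C-module of rank ≥ d at every prime, and let (c, p) be a unimodular element of C ⊕ P. Then there exist (a) a transvection τ ∈ E(C ⊕ P), (b) a finitely generated torsion-free B-module M, and (c) a unimodular element (b, m) of B ⊕ M such that: (1) M_x ≅ P_x; (2) τ maps (c, p) to (b, m); (3) b − 1 ∈ xB and m ∈ xM; and (4) x + x²g ∈ O_M(m) for some g ∈ B. -/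
/-- The order ideal `O_M(m) = { f m : f ∈ Hom_R(M, R) }`. -/
def orderIdeal (R : Type*) [CommRing R] {M : Type*} [AddCommGroup M] [Module R M]
    (m : M) : Ideal R where
  carrier := Set.range fun f : M →ₗ[R] R => f m
  add_mem' := by rintro a b ⟨f, rfl⟩ ⟨g, rfl⟩; exact ⟨f + g, rfl⟩
  zero_mem' := ⟨0, rfl⟩
  smul_mem' := by rintro c a ⟨f, rfl⟩; exact ⟨c • f, rfl⟩

/-- A transvection of a module `Q`: an automorphism of the form `1 + φ_q` where `φ ∈ Q*`,
`q ∈ Q`, `φ q = 0`, and either `q` is unimodular in `Q` or `φ` is unimodular in `Q*`. -/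
def IsTransvection {C Q : Type*} [CommRing C] [AddCommGroup Q] [Module C Q]
    (τ : Q ≃ₗ[C] Q) : Prop :=
  ∃ (φ : Q →ₗ[C] C) (q : Q), φ q = 0 ∧
    (orderIdeal C q = ⊤ ∨ orderIdeal C (M := Q →ₗ[C] C) φ = ⊤) ∧
    ∀ y : Q, τ y = y + φ y • q

/-- The rank of the localization `M_p` at a prime `p`. -/
noncomputable def rankAt {R : Type*} [CommRing R] (M : Type*) [AddCommGroup M] [Module R M]
    (p : Ideal R) (hp : p.IsPrime) : ℕ :=
  letI := hp
  Module.finrank (Localization p.primeCompl) (LocalizedModule p.primeCompl M)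

/-- The span, in `κ(Q)^ι`, of the reductions at `Q` of a family of vectors in `A^ι`. -/
noncomputable def fiberSpan {A ι κ : Type*} [CommRing A] (Q : Ideal A) [Q.IsPrime]
    (v : κ → ι → A) : Submodule Q.ResidueField (ι → Q.ResidueField) :=
  Submodule.span Q.ResidueField
    (Set.range fun (j : κ) (i : ι) => algebraMap A Q.ResidueField (v j i))

/-- The rank at `Q` of a family of vectors in `A^ι`. -/
noncomputable def fiberRank {A ι κ : Type*} [CommRing A] (Q : Ideal A) [Q.IsPrime]
    (v : κ → ι → A) : ℕ :=
  Module.finrank Q.ResidueField (fiberSpan Q v)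

/-- Clearing denominators in a residue field. -/
lemma exists_residueField_smul_eq {A ι : Type*} [CommRing A] [Finite ι] (Q : Ideal A) [Q.IsPrime]
    (w : ι → Q.ResidueField) :
    ∃ s : A, s ∉ Q ∧ ∃ u : ι → A, ∀ i,
      algebraMap A Q.ResidueField (u i) = algebraMap A Q.ResidueField s * w i := by
  obtain ⟨⟨b, hb⟩, h⟩ := IsLocalization.exist_integer_multiples_of_finite
    (nonZeroDivisors (A ⧸ Q)) w
  obtain ⟨s, rfl⟩ := Ideal.Quotient.mk_surjective b
  choose u hu using h
  choose u' hu' using fun i => Ideal.Quotient.mk_surjective (u i)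
  refine ⟨s, fun hs => ?_, u', fun i => ?_⟩
  · exact nonZeroDivisors.ne_zero hb (Ideal.Quotient.eq_zero_iff_mem.mpr hs)
  · have := hu i
    rw [← hu' i, Algebra.smul_def] at this
    simpa using this

lemma le_fiberRank_iff {A ι κ : Type*} [CommRing A] [Fintype ι] (Q : Ideal A) [Q.IsPrime]
    (v : κ → ι → A) (t : ℕ) :
    t ≤ fiberRank Q v ↔ ∃ (G : Matrix (Fin t) ι A) (σ : Fin t → κ),
      (G * (Matrix.of fun i j => v (σ j) i)).det ∉ Q := by
  classical
  constructor
  · intro h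
    obtain ⟨f, hf, -, hli⟩ := Submodule.exists_fun_fin_finrank_span_eq Q.ResidueField
      (Set.range fun (j : κ) (i : ι) => algebraMap A Q.ResidueField (v j i))
    choose τ hτ using hf
    let e : Fin t → Fin (fiberRank Q v) := Fin.castLE h
    have hli' : LinearIndependent Q.ResidueField (fun k => f (e k)) :=
      hli.comp e (Fin.castLE_injective h)
    let L : (Fin t → Q.ResidueField) →ₗ[Q.ResidueField] (ι → Q.ResidueField) :=
      Fintype.linearCombination Q.ResidueField (fun k => f (e k))
    have hL : LinearMap.ker L = ⊥ :=
      LinearMap.ker_eq_bot.mpr hli'.fintypeLinearCombination_injective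
    obtain ⟨g, hg⟩ := L.exists_leftInverse_of_injective hL
    obtain ⟨s, hs, u, hu⟩ := exists_residueField_smul_eq Q
      (fun ij : Fin t × ι => LinearMap.toMatrix' g ij.1 ij.2)
    refine ⟨Matrix.of fun i j => u (i, j), fun k => τ (e k), fun hdet => ?_⟩
    rw [← Ideal.algebraMap_residueField_eq_zero, RingHom.map_det] at hdet
    have h1 : LinearMap.toMatrix' g * LinearMap.toMatrix' L = 1 := by
      rw [← LinearMap.toMatrix'_comp, hg, LinearMap.toMatrix'_id]
    have h2 : (algebraMap A Q.ResidueField).mapMatrix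
        ((Matrix.of fun i j => u (i, j)) * (Matrix.of fun i j => v (τ (e j)) i)) =
        algebraMap A Q.ResidueField s • (1 : Matrix (Fin t) (Fin t) Q.ResidueField) := by
      rw [← h1]
      ext i j
      have hLij : ∀ k, LinearMap.toMatrix' L k j =
          algebraMap A Q.ResidueField (v (τ (e j)) k) := by
        intro k
        simp only [LinearMap.toMatrix'_apply, L]
        rw [Fintype.linearCombination_apply]
        have := congrFun (hτ (e j)) k
        simp only at this
        rw [this]
        rw [Finset.sum_eq_single j (fun c _ hc => by simp [hc]) (by simp)]
        simp
      simp only [RingHom.mapMatrix_apply, Matrix.map_apply, Matrix.mul_apply, map_sum, map_mul,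
        Matrix.of_apply, Matrix.smul_apply, smul_eq_mul, Finset.mul_sum, hLij, hu]
      exact Finset.sum_congr rfl fun k _ => by ring
    rw [h2, Matrix.det_smul, Matrix.det_one, mul_one] at hdet
    exact hs (Ideal.algebraMap_residueField_eq_zero.mp (eq_zero_of_pow_eq_zero hdet))
  · rintro ⟨G, σ, hdet⟩
    have hne : ((algebraMap A Q.ResidueField).mapMatrix
        (G * (Matrix.of fun i j => v (σ j) i))).det ≠ 0 := by
      rw [← RingHom.map_det]
      exact fun h => hdet (Ideal.algebraMap_residueField_eq_zero.mp h)
    have hli : LinearIndependent Q.ResidueField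
        (fun (k : Fin t) (i : ι) => algebraMap A Q.ResidueField (v (σ k) i)) := by
      rw [Fintype.linearIndependent_iff]
      intro g hg
      have : ((algebraMap A Q.ResidueField).mapMatrix
        (G * (Matrix.of fun i j => v (σ j) i))).mulVec g = 0 := by
        rw [RingHom.mapMatrix_apply, Matrix.map_mul, ← Matrix.mulVec_mulVec]
        have h0 : ((Matrix.of fun i j => v (σ j) i).map
            (algebraMap A Q.ResidueField)).mulVec g = 0 := by
          ext i
          have := congrFun hg i
          simp only [Finset.sum_apply, Pi.smul_apply, smul_eq_mul, Pi.zero_apply] at this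
          simpa [Matrix.mulVec, dotProduct, mul_comm] using this
        rw [h0, Matrix.mulVec_zero]
      exact congrFun (Matrix.eq_zero_of_mulVec_eq_zero hne this)
    have hle : Submodule.span Q.ResidueField
        (Set.range fun (k : Fin t) (i : ι) => algebraMap A Q.ResidueField (v (σ k) i))
        ≤ fiberSpan Q v :=
      Submodule.span_mono (by rintro _ ⟨k, rfl⟩; exact ⟨σ k, rfl⟩)
    have := Submodule.finrank_mono hle
    rwa [finrank_span_eq_card hli, Fintype.card_fin] at this

/-- Finitely many affine functions, none of them identically zero modulo the corresponding prime,
are simultaneously nonzero at some point. -/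
lemma exists_affine_avoidance {A : Type*} [CommRing A] {n : ℕ} (S : Finset (Ideal A))
    (hS : ∀ Q ∈ S, Q.IsPrime) (l : Ideal A → Fin n → A) (e : Ideal A → A)
    (hl : ∀ Q ∈ S, (∃ i, l Q i ∉ Q) ∨ e Q ∉ Q) :
    ∃ a : Fin n → A, ∀ Q ∈ S, e Q - ∑ i, l Q i * a i ∉ Q := by
  classical
  induction S using Finset.strongInduction with
  | H S ih =>
    rcases S.eq_empty_or_nonempty with rfl | hne
    · exact ⟨0, by simp⟩
    obtain ⟨Q, hQ⟩ := S.exists_minimal hne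
    have hQS := hQ.prop
    obtain ⟨a, ha⟩ := ih (S.erase Q) (Finset.erase_ssubset hQS)
      (fun P hP => hS P (Finset.mem_of_mem_erase hP))
      (fun P hP => hl P (Finset.mem_of_mem_erase hP))
    by_cases hg : e Q - ∑ i, l Q i * a i ∈ Q
    swap
    · refine ⟨a, fun P hP => ?_⟩
      by_cases hPQ : P = Q
      · rwa [hPQ]
      · exact ha P (Finset.mem_erase.mpr ⟨hPQ, hP⟩)
    have hQp := hS Q hQS
    by_cases hi : ∃ i, l Q i ∉ Q
    · obtain ⟨i, hi⟩ := hi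
      obtain ⟨u, hu, huQ⟩ : ∃ u, (∀ P ∈ S.erase Q, u ∈ P) ∧ u ∉ Q := by
        have : ¬ (S.erase Q).inf id ≤ Q := by
          rw [hQp.inf_le']
          rintro ⟨P, hP, hPQ⟩
          rw [Finset.mem_erase] at hP
          exact hP.1 (le_antisymm hPQ (hQ.le_of_le hP.2 hPQ))
        obtain ⟨u, hu, huQ⟩ := SetLike.not_le_iff_exists.mp this
        exact ⟨u, by simpa using hu, huQ⟩
      have key : ∀ P, e P - ∑ k, l P k * (a + Pi.single i u : Fin n → A) k =
          (e P - ∑ k, l P k * a k) - l P i * u := by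
        intro P
        simp only [Pi.add_apply, mul_add, Finset.sum_add_distrib]
        rw [Finset.sum_eq_single (f := fun k => l P k * (Pi.single i u : Fin n → A) k) i
          (fun k _ hk => by simp [hk]) (by simp)]
        simp only [Pi.single_eq_same]
        ring
      refine ⟨a + Pi.single i u, fun P hP => ?_⟩
      rw [key]
      by_cases hPQ : P = Q
      · subst hPQ
        rw [Submodule.sub_mem_iff_right _ hg]
        exact fun h => (hQp.mem_or_mem h).elim hi huQ
      · have hP' := Finset.mem_erase.mpr ⟨hPQ, hP⟩
        rw [Submodule.sub_mem_iff_left _ (P.mul_mem_left _ (hu P hP'))]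
        exact ha P hP'
    · have he := (hl Q hQS).resolve_left hi
      push Not at hi
      exact absurd ((Submodule.sub_mem_iff_left _ (Q.sum_mem fun i _ =>
        Q.mul_mem_right _ (hi i))).mp hg) he

lemma exists_relation_of_fiberRank_lt {A ι : Type*} [CommRing A] [Fintype ι] (Q : Ideal A)
    [Q.IsPrime] {N : ℕ} (v : Fin N → ι → A) (h : fiberRank Q v < N) :
    ∃ l : Fin N → A, (∃ j, l j ∉ Q) ∧ ∀ i, ∑ j, l j * v j i ∈ Q := by
  have hnli : ¬ LinearIndependent Q.ResidueField
      (fun (j : Fin N) (i : ι) => algebraMap A Q.ResidueField (v j i)) := by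
    intro hli
    have := finrank_span_eq_card hli
    rw [Fintype.card_fin] at this
    exact h.ne this
  obtain ⟨g, hg, j, hj⟩ := Fintype.not_linearIndependent_iff.mp hnli
  obtain ⟨s, hs, l, hl⟩ := exists_residueField_smul_eq Q g
  have hs' : algebraMap A Q.ResidueField s ≠ 0 := by
    rwa [Ne, Ideal.algebraMap_residueField_eq_zero]
  refine ⟨l, ⟨j, ?_⟩, fun i => ?_⟩
  · rw [← Ideal.algebraMap_residueField_eq_zero, hl]
    exact mul_ne_zero hs' hj
  · rw [← Ideal.algebraMap_residueField_eq_zero]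
    have := congrFun hg i
    simp only [Finset.sum_apply, Pi.smul_apply, smul_eq_mul, Pi.zero_apply] at this
    simp only [map_sum, map_mul, hl, mul_assoc, ← Finset.mul_sum, this, mul_zero]

/-- Dropping the last vector, after adding multiples of it to the others. -/
def dropLast {A ι : Type*} [CommRing A] {N : ℕ} (v : Fin (N + 1) → ι → A) (b : Fin N → A) :
    Fin N → ι → A :=
  fun j => v j.castSucc + b j • v (Fin.last N)

lemma reduction_mem_fiberSpan_dropLast {A ι : Type*} [CommRing A] (Q : Ideal A)
    [Q.IsPrime] {N : ℕ} (v : Fin (N + 1) → ι → A) (b : Fin N → A) (j : Fin N) :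
    (fun i => algebraMap A Q.ResidueField (v j.castSucc i)) +
      algebraMap A Q.ResidueField (b j) •
        (fun i => algebraMap A Q.ResidueField (v (Fin.last N) i)) ∈
      fiberSpan Q (dropLast v b) := by
  apply Submodule.subset_span
  refine ⟨j, ?_⟩
  ext i
  simp [dropLast, Algebra.smul_def]

lemma fiberSpan_le_of_last_mem {A ι : Type*} [CommRing A] (Q : Ideal A)
    [Q.IsPrime] {N : ℕ} (v : Fin (N + 1) → ι → A) (b : Fin N → A)
    (W : Submodule Q.ResidueField (ι → Q.ResidueField)) (hW : fiberSpan Q (dropLast v b) ≤ W)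
    (hlast : (fun i => algebraMap A Q.ResidueField (v (Fin.last N) i)) ∈ W) :
    fiberSpan Q v ≤ W := by
  refine Submodule.span_le.mpr ?_
  rintro _ ⟨j, rfl⟩
  induction j using Fin.lastCases with
  | last => exact hlast
  | cast j =>
    have := W.sub_mem (hW (reduction_mem_fiberSpan_dropLast Q v b j))
      (W.smul_mem (algebraMap A Q.ResidueField (b j)) hlast)
    simpa using this

lemma fiberRank_le_fiberRank_dropLast_add_one {A ι : Type*} [CommRing A] [Fintype ι] (Q : Ideal A)
    [Q.IsPrime] {N : ℕ} (v : Fin (N + 1) → ι → A) (b : Fin N → A) :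
    fiberRank Q v ≤ fiberRank Q (dropLast v b) + 1 := by
  set w : ι → Q.ResidueField := fun i => algebraMap A Q.ResidueField (v (Fin.last N) i)
  have h1 := fiberSpan_le_of_last_mem Q v b
    (fiberSpan Q (dropLast v b) ⊔ Submodule.span Q.ResidueField {w}) le_sup_left
    ((le_sup_right : _ ≤ fiberSpan Q (dropLast v b) ⊔ _) (Submodule.mem_span_singleton_self w))
  calc fiberRank Q v ≤ _ := Submodule.finrank_mono h1
    _ ≤ _ := Submodule.finrank_add_le_finrank_add_finrank _ _
    _ ≤ _ := Nat.add_le_add_left ((finrank_span_le_card _).trans (by simp)) _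

lemma fiberRank_le_fiberRank_dropLast {A ι : Type*} [CommRing A] [Fintype ι] (Q : Ideal A)
    [Q.IsPrime] {N : ℕ} (v : Fin (N + 1) → ι → A) (b : Fin N → A) (l : Fin (N + 1) → A)
    (hl : ∀ i, ∑ j, l j * v j i ∈ Q) (hb : l (Fin.last N) - ∑ j, l j.castSucc * b j ∉ Q) :
    fiberRank Q v ≤ fiberRank Q (dropLast v b) := by
  refine Submodule.finrank_mono (fiberSpan_le_of_last_mem Q v b _ le_rfl ?_)
  set φ := algebraMap A Q.ResidueField
  have hne : φ (l (Fin.last N) - ∑ j, l j.castSucc * b j) ≠ 0 := by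
    rwa [Ne, Ideal.algebraMap_residueField_eq_zero]
  have hsum := Submodule.sum_mem (fiberSpan Q (dropLast v b)) (t := Finset.univ)
    fun j _ => Submodule.smul_mem _ (-φ (l j.castSucc))
      (reduction_mem_fiberSpan_dropLast Q v b j)
  rw [← Submodule.smul_mem_iff _ hne]
  convert hsum using 1
  ext i
  have := Ideal.algebraMap_residueField_eq_zero.mpr (hl i)
  rw [Fin.sum_univ_castSucc] at this
  simp only [map_add, map_sum, map_mul] at this
  simp only [Pi.smul_apply, smul_eq_mul, map_sub, map_sum, map_mul, Finset.sum_apply, Pi.add_apply,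
    neg_mul, mul_add, Finset.sum_neg_distrib, Finset.sum_add_distrib]
  rw [sub_mul, Finset.sum_mul]
  simp only [mul_assoc] at this ⊢
  linear_combination this

/-- The ideal of minors cutting out the locus where a family has rank at most `t`. -/
def minorIdeal {A ι κ : Type*} [CommRing A] [Fintype ι] (v : κ → ι → A) (t : ℕ) : Ideal A :=
  Ideal.span {a | ∃ (G : Matrix (Fin (t + 1)) ι A) (σ : Fin (t + 1) → κ),
    a = (G * (Matrix.of fun i j => v (σ j) i)).det}

lemma minorIdeal_le_iff {A ι κ : Type*} [CommRing A] [Fintype ι] (v : κ → ι → A) (t : ℕ)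
    (Q : Ideal A) [Q.IsPrime] : minorIdeal v t ≤ Q ↔ fiberRank Q v ≤ t := by
  rw [← not_iff_not, not_le, ← Nat.succ_le_iff, Nat.succ_eq_add_one, le_fiberRank_iff,
    minorIdeal, Ideal.span_le, Set.not_subset]
  constructor
  · rintro ⟨_, ⟨G, σ, rfl⟩, h⟩
    exact ⟨G, σ, h⟩
  · rintro ⟨G, σ, h⟩
    exact ⟨_, ⟨G, σ, rfl⟩, h⟩

/-- A general position result: if the span of a family has large rank at the primes of small height
avoiding `c`, then the first vector can be changed by a multiple of `c` so as not to vanish at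
any prime of height less than `d` avoiding `c`. -/
lemma exists_height_le_of_vanishing {A ι : Type*} [CommRing A] [IsNoetherianRing A] [Fintype ι]
    (d : ℕ) (c : A) (n : ℕ) (v : Fin (n + 1) → ι → A)
    (h : ∀ (Q : Ideal A) [Q.IsPrime], c ∉ Q → ∀ t : ℕ, t ≤ n + 1 → (t : ℕ∞) + Q.height ≤ d →
      t ≤ fiberRank Q v) :
    ∃ q ∈ Submodule.span A (Set.range v), ∀ (Q : Ideal A) [Q.IsPrime], c ∉ Q →
      (∀ i, v 0 i + c * q i ∈ Q) → (d : ℕ∞) ≤ Q.height := by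
  classical
  induction n with
  | zero =>
    refine ⟨0, Submodule.zero_mem _, fun Q _ hc hv => ?_⟩
    by_contra! hlt
    have h1 := h Q hc 1 le_rfl (by
      rw [add_comm]; exact Order.add_one_le_of_lt hlt)
    have : fiberSpan Q v = ⊥ := by
      refine le_bot_iff.mp (Submodule.span_le.mpr ?_)
      rintro _ ⟨j, rfl⟩
      ext i
      have := hv i
      rw [Pi.zero_apply, mul_zero, add_zero] at this
      obtain rfl : j = 0 := Subsingleton.elim (α := Fin 1) j 0
      exact Ideal.algebraMap_residueField_eq_zero.mpr this
    rw [fiberRank, this, finrank_bot] at h1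
    omega
  | succ n ih =>
    let bad : Set (Ideal A) := {Q | ∃ _ : Q.IsPrime, c ∉ Q ∧ fiberRank Q v ≤ n + 1 ∧
      (fiberRank Q v : ℕ∞) + Q.height ≤ d}
    have hbad : bad.Finite := by
      refine Set.Finite.subset (Set.finite_iUnion fun t : Fin (n + 2) =>
        (minorIdeal v t).finite_minimalPrimes_of_isNoetherianRing) ?_
      rintro Q ⟨hQ, hc, hn, hd⟩
      refine Set.mem_iUnion.mpr ⟨⟨fiberRank Q v, by omega⟩,
        ⟨hQ, (minorIdeal_le_iff v _ Q).mpr le_rfl⟩, ?_⟩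
      rintro P ⟨hP, hPle⟩ hPQ
      have hPle' := (minorIdeal_le_iff v _ P).mp hPle
      by_contra hne
      have hlt := Ideal.height_strict_mono_of_isPrime_of_isPrime
        (lt_of_le_not_ge hPQ hne)
      have h1 := h P (fun hcP => hc (hPQ hcP)) (fiberRank Q v + 1) (by omega) (by
        refine le_trans ?_ hd
        have := Order.add_one_le_of_lt hlt
        push_cast
        rw [add_assoc, add_comm 1]
        gcongr)
      simp only at hPle'
      omega
    choose! l hl using fun Q (hQ : Q ∈ bad) =>
      have := hQ.1
      exists_relation_of_fiberRank_lt Q v (Nat.lt_succ_of_le hQ.2.2.1)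
    let m : Fin (n + 1) → A := fun j => if j = 0 then c else 1
    obtain ⟨a, ha⟩ := exists_affine_avoidance hbad.toFinset
      (fun Q hQ => (hbad.mem_toFinset.mp hQ).1) (fun Q j => l Q j.castSucc * m j)
      (fun Q => l Q (Fin.last (n + 1))) (by
        intro Q hQ
        rw [hbad.mem_toFinset] at hQ
        have hp := hQ.1
        obtain ⟨j, hj⟩ := (hl Q hQ).1
        induction j using Fin.lastCases with
        | last => exact Or.inr hj
        | cast j =>
          refine Or.inl ⟨j, fun hmem => (hp.mem_or_mem hmem).elim hj fun hm => ?_⟩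
          by_cases hj0 : j = 0
          · exact hQ.2.1 (by simpa [m, hj0] using hm)
          · exact hp.one_notMem (by simpa [m, hj0] using hm))
    let b : Fin (n + 1) → A := fun j => m j * a j
    obtain ⟨q, hq, hqv⟩ := ih (dropLast v b) (by
      intro Q _ hc t ht hd
      by_cases hbd : fiberRank Q v ≤ n + 1 ∧ (fiberRank Q v : ℕ∞) + Q.height ≤ d
      · have hQ : Q ∈ bad := ⟨inferInstance, hc, hbd⟩
        have h1 := fiberRank_le_fiberRank_dropLast Q v b (l Q) (hl Q hQ).2 (by
          simpa only [b, mul_assoc] using ha Q (hbad.mem_toFinset.mpr hQ))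
        exact (h Q hc t (by omega) hd).trans h1
      · have h1 := fiberRank_le_fiberRank_dropLast_add_one Q v b
        have h2 := h Q hc t (by omega) hd
        by_contra hlt
        have h3 : fiberRank Q v = t := by omega
        exact hbd ⟨by omega, by rwa [h3]⟩)
    refine ⟨a 0 • v (Fin.last (n + 1)) + q, Submodule.add_mem _
      (Submodule.smul_mem _ _ (Submodule.subset_span ⟨_, rfl⟩))
      (Submodule.span_le.mpr ?_ hq), fun Q _ hc hv => hqv Q hc fun i => ?_⟩
    · rintro _ ⟨j, rfl⟩
      exact Submodule.add_mem _ (Submodule.subset_span ⟨_, rfl⟩)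
        (Submodule.smul_mem _ _ (Submodule.subset_span ⟨_, rfl⟩))
    · convert hv i using 1
      simp [dropLast, b, m]
      ring

open TensorProduct in
/-- The rank of a projective module, split inside `C^ι`, is computed by the reductions of a
generating family. -/
lemma rankAt_le_fiberRank {C P ι κ : Type*} [CommRing C] [AddCommGroup P] [Module C P]
    [Module.Finite C P] [Module.Projective C P] [Fintype ι] [DecidableEq ι]
    (s : P →ₗ[C] ι → C) (r : (ι → C) →ₗ[C] P) (hrs : r ∘ₗ s = LinearMap.id)
    (w : κ → P) (hw : Submodule.span C (Set.range w) = ⊤) (Q : Ideal C) [hQ : Q.IsPrime] :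
    rankAt P Q hQ ≤ fiberRank Q (fun j => s (w j)) := by
  let φ := algebraMap C Q.ResidueField
  let l : P →ₗ[C] (ι → Q.ResidueField) :=
    (Algebra.linearMap C Q.ResidueField).compLeft ι ∘ₗ s
  have hl : ∀ p i, l p i = φ (s p i) := fun p i => rfl
  let L := l.liftBaseChange Q.ResidueField
  let R : (ι → Q.ResidueField) →ₗ[Q.ResidueField] Q.ResidueField ⊗[C] P :=
    Fintype.linearCombination Q.ResidueField
      (fun i => (1 : Q.ResidueField) ⊗ₜ[C] r (Pi.single i 1))
  have hRL : R ∘ₗ L = LinearMap.id := by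
    apply TensorProduct.AlgebraTensorModule.curry_injective
    ext p
    have h1 : r (s p) = p := LinearMap.congr_fun hrs p
    have h2 : r (s p) = ∑ i, s p i • r (Pi.single i 1) := by
      conv_lhs => rw [← Finset.univ_sum_single (s p), map_sum]
      refine Finset.sum_congr rfl fun i _ => ?_
      rw [← map_smul, ← Pi.single_smul, smul_eq_mul, mul_one]
    have h3 : R (l p) = (1 : Q.ResidueField) ⊗ₜ[C] p := by
      conv_rhs => rw [← h1, h2, TensorProduct.tmul_sum]
      simp only [R, Fintype.linearCombination_apply, hl]
      refine Finset.sum_congr rfl fun i _ => ?_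
      rw [TensorProduct.tmul_smul, TensorProduct.smul_tmul', TensorProduct.smul_tmul',
        smul_eq_mul, mul_one, Algebra.smul_def, mul_one]
    simpa [L] using h3
  have hinj : Function.Injective L :=
    Function.LeftInverse.injective (g := R) fun x => LinearMap.congr_fun hRL x
  have hlmem : ∀ p, l p ∈ fiberSpan Q (fun j => s (w j)) := by
    intro p
    have hp : p ∈ Submodule.span C (Set.range w) := hw ▸ Submodule.mem_top
    induction hp using Submodule.span_induction with
    | mem x hx =>
      obtain ⟨j, rfl⟩ := hx
      exact Submodule.subset_span ⟨j, rfl⟩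
    | zero => rw [map_zero]; exact Submodule.zero_mem _
    | add x y _ _ hx hy => rw [map_add]; exact Submodule.add_mem _ hx hy
    | smul a x _ hx =>
      rw [map_smul, ← algebraMap_smul Q.ResidueField a]
      exact Submodule.smul_mem _ _ hx
  have hmem : ∀ y, L y ∈ fiberSpan Q (fun j => s (w j)) := by
    intro y
    induction y with
    | zero => rw [map_zero]; exact Submodule.zero_mem _
    | add x y hx hy => rw [map_add]; exact Submodule.add_mem _ hx hy
    | tmul a p =>
      rw [LinearMap.liftBaseChange_tmul]
      exact Submodule.smul_mem _ _ (hlmem p)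
  have hle := LinearMap.finrank_le_finrank_of_injective
    (f := L.codRestrict _ hmem) ((LinearMap.injective_codRestrict_iff hmem).mpr hinj)
  have hrank : rankAt P Q hQ = Module.finrank Q.ResidueField (Q.ResidueField ⊗[C] P) := by
    have h1 := Module.rankAtStalk_baseChange (R := C) (M := P) (S := Q.ResidueField) ⊥
    rw [Module.rankAtStalk_eq_finrank_of_free] at h1
    have h2 : PrimeSpectrum.comap (algebraMap C Q.ResidueField) ⊥ = ⟨Q, hQ⟩ := by
      ext1
      exact Q.ker_algebraMap_residueField
    rw [h2] at h1
    exact h1.symm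
  rw [hrank]
  exact hle

lemma apply_mem_orderIdeal {R M : Type*} [CommRing R] [AddCommGroup M] [Module R M] (m : M)
    (f : M →ₗ[R] R) : f m ∈ orderIdeal R m := ⟨f, rfl⟩

/-- General position in a projective module, relative to a quotient ring. -/
lemma exists_height_le_of_orderIdeal_le {C A P : Type*} [CommRing C] [CommRing A]
    [IsNoetherianRing A] [AddCommGroup P] [Module C P] [Module.Finite C P] [Module.Projective C P]
    (f : C →+* A) (hf : Function.Surjective f) (d : ℕ)
    (hrank : ∀ (q : Ideal C) (hq : q.IsPrime), d ≤ rankAt P q hq) (c : C) (p : P) :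
    ∃ q : P, ∀ (Q : Ideal A) [Q.IsPrime], f c ∉ Q →
      orderIdeal C (p + c • q) ≤ Q.comap f → (d : ℕ∞) ≤ Q.height := by
  obtain ⟨n, r, s, -, -, hrs⟩ := Module.Finite.exists_comp_eq_id_of_projective C P
  let w : Fin (n + 1) → P := Fin.cons p fun j => r (Pi.single j 1)
  have hw : Submodule.span C (Set.range w) = ⊤ := by
    rw [eq_top_iff]
    intro y _
    have h1 : r (s y) = y := LinearMap.congr_fun hrs y
    rw [← h1, ← Finset.univ_sum_single (s y), map_sum]
    refine Submodule.sum_mem _ fun i _ => ?_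
    have : (Pi.single i (s y i) : Fin n → C) = s y i • Pi.single i 1 := by
      rw [← Pi.single_smul, smul_eq_mul, mul_one]
    rw [this, map_smul]
    exact Submodule.smul_mem _ _ (Submodule.subset_span ⟨i.succ, by simp [w]⟩)
  obtain ⟨q', hq', h⟩ := exists_height_le_of_vanishing d (f c) n (fun j i => f (s (w j) i)) (by
    intro Q _ _ t _ htd
    have htd' : t ≤ d := by exact_mod_cast le_self_add.trans htd
    refine htd'.trans ?_
    have h1 := (hrank (Q.comap f) inferInstance).trans (rankAt_le_fiberRank s r hrs w hw _)
    obtain ⟨G, σ, hdet⟩ := (le_fiberRank_iff _ _ _).mp h1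
    refine (le_fiberRank_iff _ _ _).mpr ⟨G.map f, σ, ?_⟩
    rw [Ideal.mem_comap, RingHom.map_det, RingHom.mapMatrix_apply, Matrix.map_mul] at hdet
    exact hdet)
  obtain ⟨q, hq⟩ : ∃ q : P, ∀ i, f (s q i) = q' i := by
    clear h
    induction hq' using Submodule.span_induction with
    | mem x hx =>
      obtain ⟨j, rfl⟩ := hx
      exact ⟨w j, fun i => rfl⟩
    | zero => exact ⟨0, by simp⟩
    | add x y _ _ hx hy =>
      obtain ⟨a, ha⟩ := hx
      obtain ⟨b, hb⟩ := hy
      exact ⟨a + b, by simp [ha, hb]⟩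
    | smul a x _ hx =>
      obtain ⟨a, rfl⟩ := hf a
      obtain ⟨b, hb⟩ := hx
      exact ⟨a • b, by simp [hb]⟩
  refine ⟨q, fun Q _ hc hle => h Q hc fun i => ?_⟩
  have := hle (apply_mem_orderIdeal (p + c • q) (LinearMap.proj i ∘ₗ s))
  simpa [w, hq] using this

lemma orderIdeal_le_sup_of_add_smul {R M : Type*} [CommRing R] [AddCommGroup M] [Module R M]
    (m q : M) (c : R) : orderIdeal R m ≤ orderIdeal R (m + c • q) ⊔ Ideal.span {c} := by
  rintro _ ⟨f, rfl⟩
  have h : f m = f (m + c • q) + -(f q) * c := by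
    rw [map_add, map_smul, smul_eq_mul]; ring
  simp only
  rw [h]
  exact Ideal.add_mem _ (Ideal.mem_sup_left (apply_mem_orderIdeal _ f))
    (Ideal.mem_sup_right (Ideal.mul_mem_left _ _ (Ideal.mem_span_singleton_self c)))

lemma orderIdeal_smul_le {R M : Type*} [CommRing R] [AddCommGroup M] [Module R M]
    (m : M) (c : R) : orderIdeal R (c • m) ≤ orderIdeal R m := by
  rintro _ ⟨f, rfl⟩
  simp only [map_smul]
  exact Ideal.mul_mem_left _ _ (apply_mem_orderIdeal m f)

lemma orderIdeal_prod_le {R M : Type*} [CommRing R] [AddCommGroup M] [Module R M]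
    (c : R) (m : M) : orderIdeal R ((c, m) : R × M) ≤ orderIdeal R m ⊔ Ideal.span {c} := by
  rintro _ ⟨f, rfl⟩
  have h : f (c, m) = f (0, m) + f (1, 0) * c := by
    rw [mul_comm, ← smul_eq_mul, ← map_smul, ← map_add]
    simp
  simp only
  rw [h]
  exact Ideal.add_mem _
    (Ideal.mem_sup_left (apply_mem_orderIdeal m (f ∘ₗ LinearMap.inr R R M)))
    (Ideal.mem_sup_right (Ideal.mul_mem_left _ _ (Ideal.mem_span_singleton_self c)))

lemma sup_span_eq_top_add_smul {R M : Type*} [CommRing R] [AddCommGroup M] [Module R M]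
    {m : M} {c : R} (h : orderIdeal R m ⊔ Ideal.span {c} = ⊤) (q : M) :
    orderIdeal R (m + c • q) ⊔ Ideal.span {c} = ⊤ :=
  top_le_iff.mp (h ▸ sup_le (orderIdeal_le_sup_of_add_smul m q c) le_sup_right)

lemma exists_transvection_snd {C P : Type*} [CommRing C] [AddCommGroup P] [Module C P] (q : P) :
    ∃ τ ∈ Subgroup.closure {σ : (C × P) ≃ₗ[C] (C × P) | IsTransvection σ},
      ∀ c p, τ (c, p) = (c, p + c • q) := by
  have h : LinearMap.fst C C P (0, q) = 0 := rfl
  refine ⟨LinearEquiv.transvection h, Subgroup.subset_closure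
    ⟨LinearMap.fst C C P, (0, q), h, Or.inr ?_, fun y => rfl⟩, fun c p => ?_⟩
  · rw [Ideal.eq_top_iff_one]
    exact ⟨LinearMap.applyₗ (1, 0), rfl⟩
  · simp [LinearMap.transvection.apply]

lemma exists_transvection_fst {C P : Type*} [CommRing C] [AddCommGroup P] [Module C P]
    (ψ : P →ₗ[C] C) :
    ∃ τ ∈ Subgroup.closure {σ : (C × P) ≃ₗ[C] (C × P) | IsTransvection σ},
      ∀ c p, τ (c, p) = (c + ψ p, p) := by
  have h : (ψ ∘ₗ LinearMap.snd C C P) (1, 0) = 0 := by simp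
  refine ⟨LinearEquiv.transvection h, Subgroup.subset_closure
    ⟨ψ ∘ₗ LinearMap.snd C C P, (1, 0), h, Or.inl ?_, fun y => rfl⟩, fun c p => ?_⟩
  · rw [Ideal.eq_top_iff_one]
    exact ⟨LinearMap.fst C C P, rfl⟩
  · simp [LinearMap.transvection.apply]

lemma exists_sup_span_eq_top {C P : Type*} [CommRing C] [IsNoetherianRing C]
    [AddCommGroup P] [Module C P] [Module.Finite C P] [Module.Projective C P] (d : ℕ)
    (hdC : ringKrullDim C ≤ (d : ℕ)) (x : C) (hx : x ∈ nonZeroDivisors C)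
    (hrank : ∀ (q : Ideal C) (hq : q.IsPrime), d ≤ rankAt P q hq) (c : C) (p : P)
    (hcp : orderIdeal C p ⊔ Ideal.span {c} = ⊤) :
    ∃ q : P, orderIdeal C (p + c • q) ⊔ Ideal.span {x} = ⊤ := by
  obtain ⟨q, hq⟩ := exists_height_le_of_orderIdeal_le (Ideal.Quotient.mk (Ideal.span {x}))
    Ideal.Quotient.mk_surjective d hrank c p
  refine ⟨q, ?_⟩
  by_contra hne
  obtain ⟨N, hN, hle⟩ := Ideal.exists_le_maximal _ hne
  rw [sup_le_iff] at hle
  have hker : RingHom.ker (Ideal.Quotient.mk (Ideal.span {x})) ≤ N := by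
    rw [Ideal.mk_ker]; exact hle.2
  have hcomap : (N.map (Ideal.Quotient.mk (Ideal.span {x}))).comap
      (Ideal.Quotient.mk (Ideal.span {x})) = N := by
    rw [Ideal.comap_map_of_surjective' _ Ideal.Quotient.mk_surjective, sup_eq_left]
    exact hker
  have hprime : (N.map (Ideal.Quotient.mk (Ideal.span {x}))).IsPrime :=
    Ideal.map_isPrime_of_surjective Ideal.Quotient.mk_surjective hker
  have hc : c ∉ N := by
    intro hc
    refine hN.ne_top (top_le_iff.mp ?_)
    rw [← sup_span_eq_top_add_smul hcp q]
    exact sup_le hle.1 ((Ideal.span_singleton_le_iff_mem _).mpr hc)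
  have h1 := hq (N.map (Ideal.Quotient.mk (Ideal.span {x})))
    (fun h => hc (by rwa [← Ideal.mem_comap, hcomap] at h)) (by rw [hcomap]; exact hle.1)
  have h2 := Ideal.height_le_ringKrullDim_of_ne_top hprime.ne_top
  have h3 := (ringKrullDim_quotient_succ_le_of_nonZeroDivisor hx).trans hdC
  have h4 : ((d : ℕ∞) : WithBot ℕ∞) + 1 ≤ ((d : ℕ∞) : WithBot ℕ∞) :=
    le_trans (add_le_add_left (le_trans (WithBot.coe_le_coe.mpr h1) h2) 1) h3
  have h5 : (d : ℕ∞) + 1 ≤ d := by exact_mod_cast h4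
  have h6 : d + 1 ≤ d := by exact_mod_cast h5
  omega

/-- Transvections move a unimodular element to one whose entries are congruent to `(1, 0)` modulo
`x`, with the order ideal of the second entry divided by `x` in general position. -/
lemma exists_transvections_general_position {C P : Type*} [CommRing C] [IsNoetherianRing C]
    [AddCommGroup P] [Module C P] [Module.Finite C P] [Module.Projective C P] (d : ℕ)
    (hdC : ringKrullDim C ≤ (d : ℕ)) (x : C) (hx : x ∈ nonZeroDivisors C)
    (hrank : ∀ (q : Ideal C) (hq : q.IsPrime), d ≤ rankAt P q hq) (c : C) (p : P)
    (hcp : orderIdeal C ((c, p) : C × P) = ⊤) :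
    ∃ τ ∈ Subgroup.closure {σ : (C × P) ≃ₗ[C] (C × P) | IsTransvection σ},
      ∃ (c' : C) (p' : P), τ (c, p) = (1 - x * c', x • p') ∧
        orderIdeal C p' ⊔ Ideal.span {1 - x * c'} = ⊤ ∧
        orderIdeal C p' ⊔ Ideal.span {x} = ⊤ ∧
        ∀ (Q : Ideal C) [Q.IsPrime], orderIdeal C p' ≤ Q → (d : ℕ∞) ≤ Q.height := by
  have u0 : orderIdeal C p ⊔ Ideal.span {c} = ⊤ := top_le_iff.mp (hcp ▸ orderIdeal_prod_le c p)
  obtain ⟨q₁, h₁⟩ := exists_sup_span_eq_top d hdC x hx hrank c p u0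
  have u1 := sup_span_eq_top_add_smul u0 q₁
  obtain ⟨τ₁, hτ₁, e₁⟩ := exists_transvection_snd (C := C) q₁
  set p₁ := p + c • q₁
  obtain ⟨_, ⟨φ, rfl⟩, y, hy, hφ⟩ := Submodule.mem_sup.mp ((Ideal.eq_top_iff_one _).mp h₁)
  obtain ⟨h, rfl⟩ := Ideal.mem_span_singleton'.mp hy
  simp only at hφ
  obtain ⟨τ₂, hτ₂, e₂⟩ := exists_transvection_fst (C := C) ((1 - c) • φ)
  set c' := (1 - c) * h with hc'
  have hc₁ : c + ((1 - c) • φ) p₁ = 1 - x * c' := by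
    rw [LinearMap.smul_apply, smul_eq_mul, hc']
    linear_combination (1 - c) * hφ
  have u2 : orderIdeal C p₁ ⊔ Ideal.span {1 - x * c'} = ⊤ := by
    rw [← hc₁]
    refine top_le_iff.mp (u1 ▸ sup_le le_sup_left ?_)
    rw [Ideal.span_singleton_le_iff_mem]
    refine (Ideal.add_mem_iff_left _ (b := ((1 - c) • φ) p₁) ?_).mp
      (Ideal.mem_sup_right (Ideal.mem_span_singleton_self _))
    exact Ideal.mem_sup_left (apply_mem_orderIdeal p₁ ((1 - c) • φ))
  obtain ⟨τ₃, hτ₃, e₃⟩ := exists_transvection_snd (C := C) (-p₁)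
  have hp₂ : p₁ + (1 - x * c') • -p₁ = x • c' • p₁ := by module
  have u3 : orderIdeal C (c' • p₁) ⊔ Ideal.span {1 - x * c'} = ⊤ := by
    have := sup_span_eq_top_add_smul u2 (-p₁)
    rw [hp₂] at this
    exact top_le_iff.mp (this ▸ sup_le_sup_right (orderIdeal_smul_le (c' • p₁) x) _)
  set p₂ := c' • p₁
  obtain ⟨q₄, h₄⟩ := exists_sup_span_eq_top d hdC x hx hrank _ p₂ u3
  have u4 := sup_span_eq_top_add_smul u3 q₄
  obtain ⟨τ₄, hτ₄, e₄⟩ := exists_transvection_snd (C := C) (x • q₄)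
  set p₄ := p₂ + (1 - x * c') • q₄ with hp₄
  obtain ⟨q₅, h₅⟩ := exists_height_le_of_orderIdeal_le (RingHom.id C) Function.surjective_id d
    hrank ((1 - x * c') * x) p₄
  obtain ⟨τ₅, hτ₅, e₅⟩ := exists_transvection_snd (C := C) (x • x • q₅)
  have u5 : orderIdeal C (p₄ + ((1 - x * c') * x) • q₅) ⊔ Ideal.span {1 - x * c'} = ⊤ := by
    rw [mul_smul]
    exact sup_span_eq_top_add_smul u4 _
  have h₅' : orderIdeal C (p₄ + ((1 - x * c') * x) • q₅) ⊔ Ideal.span {x} = ⊤ := by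
    rw [mul_comm, mul_smul]
    exact sup_span_eq_top_add_smul h₄ _
  refine ⟨τ₅ * τ₄ * τ₃ * τ₂ * τ₁, mul_mem (mul_mem (mul_mem (mul_mem hτ₅ hτ₄) hτ₃) hτ₂) hτ₁,
    c', p₄ + ((1 - x * c') * x) • q₅, ?_, u5, h₅', fun Q hQ hle => h₅ Q ?_ hle⟩
  · simp only [LinearEquiv.mul_apply]
    rw [e₁, e₂, hc₁, e₃, hp₂, e₄, e₅, hp₄]
    congr 1
    module
  · intro hmem
    rcases hQ.mem_or_mem hmem with hm | hm
    · exact hQ.ne_top (top_le_iff.mp (u5 ▸ sup_le hle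
        ((Ideal.span_singleton_le_iff_mem _).mpr hm)))
    · exact hQ.ne_top (top_le_iff.mp (h₅' ▸ sup_le hle
        ((Ideal.span_singleton_le_iff_mem _).mpr hm)))

lemma isLocalization_away_of_eventually_mem {B C : Type*} [CommRing B] [CommRing C] [Algebra B C]
    (hinj : Function.Injective (algebraMap B C)) (x : B)
    (hx : ∀ c : C, ∃ (k : ℕ) (b : B), (algebraMap B C x) ^ k * c = algebraMap B C b) :
    IsLocalization.Away x (Localization.Away (algebraMap B C x)) := by
  set S := Localization.Away (algebraMap B C x)
  have hu : IsUnit (algebraMap B S x) := by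
    rw [IsScalarTower.algebraMap_apply B C S]
    exact IsLocalization.Away.algebraMap_isUnit _
  refine ⟨?_, fun z => ?_, fun {a b} h => ?_⟩
  · rintro ⟨_, n, rfl⟩
    simpa using hu.pow n
  · obtain ⟨⟨c, ⟨_, n, rfl⟩⟩, hc⟩ := IsLocalization.surj (Submonoid.powers (algebraMap B C x)) z
    obtain ⟨k, b, hb⟩ := hx c
    refine ⟨⟨b, ⟨x ^ (n + k), n + k, rfl⟩⟩, ?_⟩
    have e := congrArg (algebraMap C S) hb
    rw [map_mul, map_pow, ← IsScalarTower.algebraMap_apply, ← IsScalarTower.algebraMap_apply] at e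
    change z * algebraMap C S (algebraMap B C x ^ n) = algebraMap C S c at hc
    rw [map_pow, ← IsScalarTower.algebraMap_apply] at hc
    change z * algebraMap B S (x ^ (n + k)) = algebraMap B S b
    rw [← e, ← hc, map_pow, pow_add]
    ring
  · rw [IsScalarTower.algebraMap_apply B C S, IsScalarTower.algebraMap_apply B C S] at h
    obtain ⟨⟨_, n, rfl⟩, hc⟩ :=
      IsLocalization.exists_of_eq (M := Submonoid.powers (algebraMap B C x)) h
    refine ⟨⟨x ^ n, n, rfl⟩, hinj ?_⟩
    simpa using hc

/-- If every prime over `J` has height at least `dim B`, the contraction of `J` to `B` is comaximal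
with `x` as soon as `J` is. -/
lemma comap_sup_span_eq_top {B C : Type*} [CommRing B] [CommRing C] [IsNoetherianRing B]
    [Algebra B C] (hinj : Function.Injective (algebraMap B C)) (d : ℕ)
    (hdB : ringKrullDim B ≤ (d : ℕ)) (x : B)
    (hx : ∀ c : C, ∃ (k : ℕ) (b : B), (algebraMap B C x) ^ k * c = algebraMap B C b)
    (J : Ideal C) (hJx : J ⊔ Ideal.span {algebraMap B C x} = ⊤)
    (hJ : ∀ (Q : Ideal C) [Q.IsPrime], J ≤ Q → (d : ℕ∞) ≤ Q.height) :
    J.comap (algebraMap B C) ⊔ Ideal.span {x} = ⊤ := by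
  by_contra hne
  obtain ⟨N, hN, hle⟩ := Ideal.exists_le_maximal _ hne
  rw [sup_le_iff, Ideal.span_singleton_le_iff_mem] at hle
  have hreg : ∀ c, algebraMap B C x * c ∈ J → c ∈ J := by
    intro c hc
    obtain ⟨j, hj, y, hy, h1⟩ := Submodule.mem_sup.mp ((Ideal.eq_top_iff_one _).mp hJx)
    obtain ⟨a, rfl⟩ := Ideal.mem_span_singleton'.mp hy
    have : c = j * c + a * (algebraMap B C x * c) := by linear_combination -c * h1
    rw [this]
    exact Ideal.add_mem _ (Ideal.mul_mem_right _ _ hj) (Ideal.mul_mem_left _ _ hc)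
  have hregpow : ∀ (k : ℕ) c, algebraMap B C x ^ k * c ∈ J → c ∈ J := by
    intro k
    induction k with
    | zero => simp
    | succ k ih => exact fun c hc => ih c (hreg _ (by rwa [← mul_assoc, ← pow_succ']))
  obtain ⟨p, hp, hJp, hdisj⟩ := Ideal.exists_le_prime_disjoint (J.comap (algebraMap B C))
    (N.primeCompl ⊔ Submonoid.powers x) (by
      rw [Set.disjoint_left]
      rintro a ha ha'
      obtain ⟨s, hs, _, ⟨k, rfl⟩, rfl⟩ := Submonoid.mem_sup.mp ha'
      refine hs (hle.1 (hregpow k _ ?_))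
      have : algebraMap B C (s * x ^ k) ∈ J := ha
      rwa [map_mul, map_pow, mul_comm] at this)
  have hxp : Disjoint (Submonoid.powers x : Set B) p :=
    (hdisj.mono_right (SetLike.coe_subset_coe.mpr le_sup_right)).symm
  have hpN : p < N := by
    refine lt_of_le_of_ne (fun a ha => ?_) ?_
    · by_contra haN
      exact Set.disjoint_left.mp hdisj ha ((le_sup_left : N.primeCompl ≤ _) haN)
    · rintro rfl
      exact Set.disjoint_left.mp hxp ⟨1, pow_one x⟩ hle.2
  have hloc := isLocalization_away_of_eventually_mem hinj x hx
  set S := Localization.Away (algebraMap B C x)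
  set pS := p.map (algebraMap B S)
  have hpS : pS.IsPrime :=
    IsLocalization.isPrime_of_isPrime_disjoint (Submonoid.powers x) S p hp hxp
  have hunder : pS.under B = p :=
    IsLocalization.under_map_of_isPrime_disjoint (Submonoid.powers x) S hp hxp
  have e1 : p.height = pS.height := by
    rw [← IsLocalization.height_under (Submonoid.powers x) pS, hunder]
  have e2 : (pS.under C).height = pS.height :=
    IsLocalization.height_under (Submonoid.powers (algebraMap B C x)) pS
  have hJ' : J ≤ pS.under C := by
    intro c hc
    obtain ⟨k, b, hb⟩ := hx c
    have hbp : b ∈ p := hJp (by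
      rw [Ideal.mem_comap, ← hb]
      exact J.mul_mem_left _ hc)
    have hbS := Ideal.mem_map_of_mem (algebraMap B S) hbp
    rw [IsScalarTower.algebraMap_apply B C S, ← hb, map_mul, map_pow] at hbS
    exact (Ideal.unit_mul_mem_iff_mem pS
      ((IsLocalization.Away.algebraMap_isUnit (S := S) (algebraMap B C x)).pow k)).mp hbS
  have h1 : (d : ℕ∞) ≤ p.height := by
    rw [e1, ← e2]
    exact hJ _ hJ'
  have h2 : (N.height : WithBot ℕ∞) ≤ ((d : ℕ∞) : WithBot ℕ∞) :=
    (Ideal.height_le_ringKrullDim_of_ne_top hN.ne_top).trans hdB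
  have h3 := Ideal.height_strict_mono_of_isPrime_of_isPrime hpN
  exact absurd (WithBot.coe_le_coe.mp h2) (not_le.mpr (h1.trans_lt h3))

/-- A linear form over `C` taking values in `B` on a `B`-submodule descends to a form over `B`. -/
lemma exists_descended_form {B C P : Type*} [CommRing B] [CommRing C] [Algebra B C]
    (hinj : Function.Injective (algebraMap B C)) [AddCommGroup P] [Module C P] [Module B P]
    [IsScalarTower B C P] (s : Set P) (f : P →ₗ[C] C)
    (hf : ∀ y ∈ s, ∃ b : B, f y = algebraMap B C b) :
    ∃ g : Submodule.span B s →ₗ[B] B, ∀ y, algebraMap B C (g y) = f y := by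
  let f' : Submodule.span B s →ₗ[B] C := (f.restrictScalars B).domRestrict _
  have hrange : ∀ y, f' y ∈ LinearMap.range (Algebra.linearMap B C) := by
    have h : Submodule.span B s ≤
        (LinearMap.range (Algebra.linearMap B C)).comap (f.restrictScalars B) := by
      refine Submodule.span_le.mpr fun y hy => ?_
      obtain ⟨b, hb⟩ := hf y hy
      exact ⟨b, hb.symm⟩
    exact fun y => h y.2
  let e := LinearEquiv.ofInjective (Algebra.linearMap B C) hinj
  refine ⟨e.symm.toLinearMap ∘ₗ f'.codRestrict _ hrange, fun y => ?_⟩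
  exact congrArg Subtype.val (e.apply_symm_apply (f'.codRestrict _ hrange y))

lemma exists_uniform_power_mem {B C ι : Type*} [CommRing B] [CommRing C] [Algebra B C] (x : B)
    (hx : ∀ c : C, ∃ (k : ℕ) (b : B), (algebraMap B C x) ^ k * c = algebraMap B C b)
    (s : Finset ι) (f : ι → C) :
    ∃ k : ℕ, ∀ i ∈ s, ∃ b : B, (algebraMap B C x) ^ k * f i = algebraMap B C b := by
  choose k b hb using fun i => hx (f i)
  refine ⟨s.sup k, fun i hi => ⟨x ^ (s.sup k - k i) * b i, ?_⟩⟩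
  rw [map_mul, ← hb, ← mul_assoc, map_pow, ← pow_add, Nat.sub_add_cancel (Finset.le_sup hi)]

lemma nonempty_localizedModule_equiv {B P : Type*} [CommRing B] [AddCommGroup P] [Module B P]
    (x : B) (M : Submodule B P) (hM : ∀ y : P, ∃ n : ℕ, x ^ n • y ∈ M) :
    Nonempty ((LocalizedModule (Submonoid.powers x) M) ≃ₗ[B]
      (LocalizedModule (Submonoid.powers x) P)) := by
  let f := LocalizedModule.mkLinearMap (Submonoid.powers x) P ∘ₗ M.subtype
  have : IsLocalizedModule (Submonoid.powers x) f := by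
    refine ⟨IsLocalizedModule.map_units (LocalizedModule.mkLinearMap _ P), fun z => ?_,
      fun {a b} h => ?_⟩
    · obtain ⟨⟨y, ⟨_, k, rfl⟩⟩, hy⟩ := IsLocalizedModule.surj (Submonoid.powers x)
        (LocalizedModule.mkLinearMap (Submonoid.powers x) P) z
      obtain ⟨n, hn⟩ := hM y
      refine ⟨⟨⟨_, hn⟩, ⟨x ^ (n + k), n + k, rfl⟩⟩, ?_⟩
      change x ^ k • z = LocalizedModule.mkLinearMap (Submonoid.powers x) P y at hy
      change x ^ (n + k) • z = LocalizedModule.mkLinearMap (Submonoid.powers x) P (x ^ n • y)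
      rw [map_smul, ← hy, smul_smul, pow_add]
    · obtain ⟨c, hc⟩ := IsLocalizedModule.exists_of_eq (S := Submonoid.powers x)
        (f := LocalizedModule.mkLinearMap (Submonoid.powers x) P) h
      exact ⟨c, Subtype.ext hc⟩
  exact ⟨IsLocalizedModule.iso (Submonoid.powers x) f⟩

lemma map_mem_nonZeroDivisors_of_eventually_mem {B C : Type*} [CommRing B] [CommRing C]
    [Algebra B C] (hinj : Function.Injective (algebraMap B C)) (x : B)
    (hxC : algebraMap B C x ∈ nonZeroDivisors C)
    (hx : ∀ c : C, ∃ (k : ℕ) (b : B), (algebraMap B C x) ^ k * c = algebraMap B C b)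
    {r : B} (hr : r ∈ nonZeroDivisors B) : algebraMap B C r ∈ nonZeroDivisors C := by
  rw [mem_nonZeroDivisors_iff_right]
  intro c hc
  obtain ⟨k, b, hb⟩ := hx c
  have h0 : b * r = 0 := hinj (by rw [map_mul, map_zero, ← hb, mul_assoc, hc, mul_zero])
  rw [(mem_nonZeroDivisors_iff_right.mp hr) b h0, map_zero] at hb
  exact (mem_nonZeroDivisors_iff.mp (pow_mem hxC k)).1 c hb

lemma eq_zero_of_smul_eq_zero {C P : Type*} [CommRing C] [AddCommGroup P] [Module C P]
    [Module.Finite C P] [Module.Projective C P] {c : C} (hc : c ∈ nonZeroDivisors C) {y : P}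
    (h : c • y = 0) : y = 0 := by
  obtain ⟨n, r, s, -, -, hrs⟩ := Module.Finite.exists_comp_eq_id_of_projective C P
  have hs : s y = 0 := by
    funext i
    refine (mem_nonZeroDivisors_iff.mp hc).1 _ ?_
    have := congrFun (congrArg s h) i
    rwa [map_smul, map_zero] at this
  rw [← LinearMap.id_apply (R := C) y, ← hrs, LinearMap.comp_apply, hs, map_zero]

/-- If the contraction of `J` to `B` is comaximal with `x`, then `B → C ⧸ J` is surjective. -/
lemma exists_sub_algebraMap_mem {B C : Type*} [CommRing B] [CommRing C] [Algebra B C] (x : B)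
    (hx : ∀ c : C, ∃ (k : ℕ) (b : B), (algebraMap B C x) ^ k * c = algebraMap B C b)
    (J : Ideal C) (hJ : J.comap (algebraMap B C) ⊔ Ideal.span {x} = ⊤) (c : C) :
    ∃ b : B, c - algebraMap B C b ∈ J := by
  obtain ⟨k, b, hb⟩ := hx c
  have hk : J.comap (algebraMap B C) ⊔ Ideal.span {x ^ k} = ⊤ := by
    rw [← Ideal.span_singleton_pow]
    exact Ideal.sup_pow_eq_top hJ
  obtain ⟨β, hβ, z, hz, h1⟩ := Submodule.mem_sup.mp ((Ideal.eq_top_iff_one _).mp hk)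
  obtain ⟨y, rfl⟩ := Ideal.mem_span_singleton'.mp hz
  refine ⟨y * b, ?_⟩
  have e := congrArg (algebraMap B C) h1
  simp only [map_add, map_mul, map_pow, map_one] at e
  have : c - algebraMap B C (y * b) = c * algebraMap B C β := by
    rw [map_mul, ← hb]
    linear_combination -c * e
  rw [this]
  exact J.mul_mem_left _ hβ

lemma smul_mem_of_pow_smul_mem {B C P ι : Type*} [CommRing B] [CommRing C] [Algebra B C]
    [AddCommGroup P] [Module C P] [Module B P] [IsScalarTower B C P] (x : B)
    (hx : ∀ c : C, ∃ (k : ℕ) (b : B), (algebraMap B C x) ^ k * c = algebraMap B C b)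
    (w : ι → P) (hw : Submodule.span C (Set.range w) = ⊤) (k : ℕ) (M : Submodule B P)
    (hM : ∀ i, x ^ k • w i ∈ M) (y : P) : ∃ n : ℕ, x ^ n • y ∈ M := by
  have hy : y ∈ Submodule.span C (Set.range w) := hw ▸ Submodule.mem_top
  have hmono : ∀ {y : P} {n : ℕ} (j : ℕ), x ^ n • y ∈ M → x ^ (j + n) • y ∈ M := by
    intro y n j h
    rw [pow_add, mul_smul]
    exact M.smul_mem _ h
  suffices h : ∀ c : C, ∃ n : ℕ, x ^ n • c • y ∈ M by simpa using h 1
  induction hy using Submodule.span_induction with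
  | mem y hy =>
    obtain ⟨i, rfl⟩ := hy
    intro c
    obtain ⟨l, b, hb⟩ := hx c
    refine ⟨k + l, ?_⟩
    have : x ^ (k + l) • c • w i = b • x ^ k • w i := by
      rw [pow_add, mul_smul, ← algebraMap_smul C (x ^ l), smul_smul, map_pow, hb, algebraMap_smul,
        smul_comm]
    rw [this]
    exact M.smul_mem _ (hM i)
  | zero => exact fun c => ⟨0, by simp⟩
  | add y z _ _ ihy ihz =>
    intro c
    obtain ⟨n, hn⟩ := ihy c
    obtain ⟨l, hl⟩ := ihz c
    refine ⟨l + n, ?_⟩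
    rw [smul_add, smul_add]
    exact M.add_mem (hmono l hn) (by rw [add_comm]; exact hmono n hl)
  | smul a y _ ih =>
    intro c
    simpa only [smul_smul] using ih (c * a)

lemma orderIdeal_prod_eq_top {R M : Type*} [CommRing R] [AddCommGroup M] [Module R M]
    {b : R} {m : M} (f : M →ₗ[R] R) (h : IsCoprime b (f m)) :
    orderIdeal R ((b, m) : R × M) = ⊤ := by
  obtain ⟨u, v, huv⟩ := h
  rw [Ideal.eq_top_iff_one]
  exact ⟨u • LinearMap.fst R R M + v • (f ∘ₗ LinearMap.snd R R M), huv⟩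

theorem stmt_6 {B C : Type*} [CommRing B] [CommRing C]
    [IsNoetherianRing B] [IsNoetherianRing C] [IsReduced B] [IsReduced C] [Algebra B C]
    (hinj : Function.Injective (algebraMap B C)) (d : ℕ) (hd : 1 ≤ d)
    (hdB : ringKrullDim B = (d : ℕ)) (hdC : ringKrullDim C = (d : ℕ))
    (x : B) (hxC : algebraMap B C x ∈ nonZeroDivisors C)
    (hx : ∀ c : C, ∃ (k : ℕ) (b : B), (algebraMap B C x) ^ k * c = algebraMap B C b)
    (P : Type*) [AddCommGroup P] [Module C P] [Module.Finite C P] [Module.Projective C P]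
    [Module B P] [IsScalarTower B C P]
    (hrank : ∀ (q : Ideal C) (hq : q.IsPrime), d ≤ rankAt P q hq)
    (c : C) (p : P) (hcp : orderIdeal C ((c, p) : C × P) = ⊤) :
    ∃ τ ∈ Subgroup.closure {σ : (C × P) ≃ₗ[C] (C × P) | IsTransvection σ},
      ∃ (M : Submodule B P) (b : B) (m : P) (hm : m ∈ M),
        M.FG ∧
        (∀ y ∈ M, ∀ r ∈ nonZeroDivisors B, r • y = (0 : P) → y = 0) ∧
        Nonempty ((LocalizedModule (Submonoid.powers x) M) ≃ₗ[B]
          (LocalizedModule (Submonoid.powers x) P)) ∧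
        τ (c, p) = (algebraMap B C b, m) ∧
        orderIdeal B ((b, ⟨m, hm⟩) : B × M) = ⊤ ∧
        b - 1 ∈ Ideal.span {x} ∧
        m ∈ (Ideal.span {x} : Ideal B) • M ∧
        ∃ g : B, x + x ^ 2 * g ∈ orderIdeal B (⟨m, hm⟩ : M) := by
  obtain ⟨τ, hτ, c', p', e, hJc, hJx, hJht⟩ := exists_transvections_general_position d hdC.le
    (algebraMap B C x) hxC hrank c p hcp
  have hcomax := comap_sup_span_eq_top hinj d hdB.le x hx (orderIdeal C p') hJx hJht
  have hlift := exists_sub_algebraMap_mem x hx (orderIdeal C p') hcomax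
  obtain ⟨b₁, ψ, hψ⟩ := hlift c'
  obtain ⟨σ, hσ, eσ⟩ := exists_transvection_fst (C := C) ψ
  simp only at hψ
  obtain ⟨β, ⟨f, hf⟩, z, hz, h1⟩ := Submodule.mem_sup.mp ((Ideal.eq_top_iff_one _).mp hcomax)
  obtain ⟨g₀, rfl⟩ := Ideal.mem_span_singleton'.mp hz
  simp only at hf
  obtain ⟨n, w, hw⟩ := Module.Finite.exists_fin (R := C) (M := P)
  obtain ⟨k, hk⟩ := exists_uniform_power_mem x hx Finset.univ (fun i => f (w i))
  set s : Set P := insert p' (Set.range fun i => x ^ k • w i) with hs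
  have hsfin : s.Finite := (Set.finite_range _).insert p'
  have hp' : p' ∈ Submodule.span B s := Submodule.subset_span (Set.mem_insert _ _)
  have hm : x • p' ∈ Submodule.span B s := Submodule.smul_mem _ _ hp'
  refine ⟨σ * τ, mul_mem hσ hτ, Submodule.span B s, 1 - x * b₁, x • p', hm,
    Submodule.fg_span hsfin, ?_, ?_, ?_, ?_, ?_, ?_, -g₀, ?_⟩
  · intro y _ r hr h
    refine eq_zero_of_smul_eq_zero
      (map_mem_nonZeroDivisors_of_eventually_mem hinj x hxC hx hr) (y := y) ?_
    rwa [algebraMap_smul]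
  · exact nonempty_localizedModule_equiv x _ (smul_mem_of_pow_smul_mem x hx w hw k _
      fun i => Submodule.subset_span (Set.mem_insert_of_mem _ ⟨i, rfl⟩))
  · rw [LinearEquiv.mul_apply, e, eσ, map_smul, hψ, algebraMap_smul C x p']
    congr 1
    simp only [map_sub, map_mul, map_one, smul_eq_mul]
    ring
  · obtain ⟨_, ⟨ψ₁, rfl⟩, u, hu, h2⟩ := Submodule.mem_sup.mp ((Ideal.eq_top_iff_one _).mp hJc)
    obtain ⟨a, rfl⟩ := Ideal.mem_span_singleton'.mp hu
    obtain ⟨y', ψ₂, hψ₂⟩ := hlift a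
    simp only at h2 hψ₂
    set f' := ψ₁ - (a * algebraMap B C x) • ψ + algebraMap B C (1 - x * b₁) • ψ₂ with hf'
    have ht : f' p' = algebraMap B C (1 - (1 - x * b₁) * y') := by
      simp only [hf', LinearMap.add_apply, LinearMap.sub_apply, LinearMap.smul_apply, smul_eq_mul,
        hψ, hψ₂, map_sub, map_mul, map_one]
      linear_combination h2
    obtain ⟨K, hK⟩ := exists_uniform_power_mem x hx hsfin.toFinset f'
    obtain ⟨g, hg⟩ := exists_descended_form hinj s (algebraMap B C x ^ K • f')
      fun y hy => hK y (hsfin.mem_toFinset.mpr hy)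
    have hgm : g ⟨x • p', hm⟩ = x ^ (K + 1) * (1 - (1 - x * b₁) * y') := by
      refine hinj ?_
      rw [hg]
      simp only
      rw [← algebraMap_smul C x p', map_smul, LinearMap.smul_apply, ht, smul_eq_mul, smul_eq_mul,
        ← map_pow, ← map_mul, ← map_mul]
      congr 1
      ring
    refine orderIdeal_prod_eq_top g ?_
    rw [hgm]
    exact IsCoprime.mul_right (IsCoprime.pow_right ⟨1, b₁, by ring⟩) ⟨y', 1, by ring⟩
  · rw [Ideal.mem_span_singleton]
    exact ⟨-b₁, by ring⟩
  · exact Submodule.smul_mem_smul (Ideal.mem_span_singleton_self x) hp'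
  · obtain ⟨g, hg⟩ := exists_descended_form hinj s f (by
      rintro y (rfl | ⟨i, rfl⟩)
      · exact ⟨β, hf⟩
      · obtain ⟨b, hb⟩ := hk i (Finset.mem_univ i)
        refine ⟨b, ?_⟩
        simp only
        rw [← hb, ← algebraMap_smul C (x ^ k), map_smul, map_pow, smul_eq_mul])
    refine ⟨g, hinj ?_⟩
    simp only
    rw [hg]
    simp only
    rw [← algebraMap_smul C, map_smul, hf, smul_eq_mul, ← map_mul]
    congr 1
    linear_combination x * h1
end

section
/- Let B ⊆ C be reduced commutative Noetherian rings with dim(B) = dim(C) = d ≥ 1, and let x ∈ B be a non-zero divisor in C such that B_x = C_x. Then the canonical map Um_{d+1}(B)/E_{d+1}(B) → Um_{d+1}(C)/E_{d+1}(C) is surjective; that is, for every unimodular row u ∈ Um_{d+1}(C) there exist ε ∈ E_{d+1}(C) and a row v with all entries in B such that uε = v and v is a unimodular row over B. -/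
section Avoidance

variable {R : Type*} [CommRing R]

/-- Prime avoidance for a coset `a + a₀R`. -/
theorem Ideal.exists_add_mul_notMem_of_isPrime (a₀ a : R) (S : Finset (Ideal R))
    (hS : ∀ Q ∈ S, Q.IsPrime ∧ a₀ ∉ Q) : ∃ c : R, ∀ Q ∈ S, a + c * a₀ ∉ Q := by
  classical
  induction S using Finset.strongInduction with
  | H S ih =>
    rcases S.eq_empty_or_nonempty with rfl | hne
    · exact ⟨0, by simp⟩
    obtain ⟨Q, hQS, hQmin⟩ := S.exists_minimal hne
    obtain ⟨c, hc⟩ := ih (S.erase Q) (Finset.erase_ssubset hQS)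
      fun P hP => hS P (Finset.mem_of_mem_erase hP)
    by_cases hcQ : a + c * a₀ ∈ Q
    · have hprod : ¬ (∏ P ∈ S.erase Q, P) ≤ Q := by
        rw [(hS Q hQS).1.prod_le]
        rintro ⟨P, hP, hPQ⟩
        exact Finset.ne_of_mem_erase hP
          (le_antisymm hPQ (hQmin (Finset.mem_of_mem_erase hP) hPQ))
      obtain ⟨μ, hμ, hμQ⟩ := SetLike.not_le_iff_exists.mp hprod
      refine ⟨c + μ, fun P hP hmem => ?_⟩
      have hsplit : a + (c + μ) * a₀ = (a + c * a₀) + μ * a₀ := by ring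
      rw [hsplit] at hmem
      by_cases hPQ : P = Q
      · subst hPQ
        have hprime := (hS P hP).1
        rw [Ideal.add_mem_iff_right _ hcQ] at hmem
        exact (hprime.mem_or_mem hmem).elim hμQ (hS P hP).2
      · have hPe : P ∈ S.erase Q := Finset.mem_erase.mpr ⟨hPQ, hP⟩
        have hμP : μ ∈ P := (Ideal.prod_le_inf.trans (Finset.inf_le hPe) : _ ≤ P) hμ
        exact hc P hPe ((Ideal.add_mem_iff_left _ (P.mul_mem_right _ hμP)).mp hmem)
    · refine ⟨c, fun P hP => ?_⟩
      by_cases hPQ : P = Q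
      · exact hPQ ▸ hcQ
      · exact hc P (Finset.mem_erase.mpr ⟨hPQ, hP⟩)

/-- In a Noetherian ring, multiples of `a₀` can be added to the entries `a i`, `i ∈ s`, so that every
prime containing the new entries but not `a₀` has height at least `#s`, and at least `#s + 1` if it
also contains the non-zero-divisor `x`. -/
theorem Ideal.exists_add_mul_card_le_height [IsNoetherianRing R] {ι : Type*} (a₀ : R) {x : R}
    (hx : x ∈ nonZeroDivisors R) (a : ι → R) (s : Finset ι) :
    ∃ c : ι → R, ∀ P : Ideal R, P.IsPrime → a₀ ∉ P → (∀ i ∈ s, a i + c i * a₀ ∈ P) →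
      (s.card : ℕ∞) ≤ P.height ∧ (x ∈ P → (s.card : ℕ∞) + 1 ≤ P.height) := by
  classical
  induction s using Finset.induction_on with
  | empty =>
    refine ⟨0, fun P hP _ _ => ⟨by simp, fun hxP => ?_⟩⟩
    simpa using (Ideal.one_le_height_span_singleton_of_mem_nonZeroDivisors hx).trans
      (Ideal.height_mono ((Ideal.span_singleton_le_iff_mem P).mpr hxP))
  | insert j s hj ih =>
    obtain ⟨c, hc⟩ := ih
    set I : Ideal R := Ideal.span ((fun i => a i + c i * a₀) '' s) with hI
    set I' : Ideal R := I ⊔ Ideal.span {x} with hI'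
    have hfin : (I.minimalPrimes ∪ I'.minimalPrimes).Finite :=
      I.finite_minimalPrimes_of_isNoetherianRing.union I'.finite_minimalPrimes_of_isNoetherianRing
    obtain ⟨e, he⟩ := Ideal.exists_add_mul_notMem_of_isPrime a₀ (a j)
      (hfin.toFinset.filter fun Q => a₀ ∉ Q) (by
        intro Q hQ
        simp only [Finset.mem_filter, Set.Finite.mem_toFinset] at hQ
        exact ⟨hQ.1.elim (fun h => h.isPrime) (fun h => h.isPrime), hQ.2⟩)
    have hmemI {Q : Ideal R} (hQ : I ≤ Q) (i : ι) (hi : i ∈ s) : a i + c i * a₀ ∈ Q :=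
      hQ (Ideal.subset_span ⟨i, hi, rfl⟩)
    refine ⟨Function.update c j e, fun P hP ha₀ hmem => ?_⟩
    have hjP : a j + e * a₀ ∈ P := by simpa using hmem j (Finset.mem_insert_self _ _)
    have hIP : I ≤ P := by
      rw [hI, Ideal.span_le]
      rintro _ ⟨i, hi, rfl⟩
      have hij : i ≠ j := fun h => hj (h ▸ hi)
      simpa [hij] using hmem i (Finset.mem_insert_of_mem hi)
    have hlt {Q : Ideal R} (hQ : Q ∈ I.minimalPrimes ∪ I'.minimalPrimes) (hQP : Q ≤ P) :
        Q < P ∧ a₀ ∉ Q := by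
      have ha₀Q : a₀ ∉ Q := fun h => ha₀ (hQP h)
      refine ⟨lt_of_le_of_ne hQP ?_, ha₀Q⟩
      rintro rfl
      exact he Q (by simpa using ⟨hQ, ha₀Q⟩) hjP
    rw [Finset.card_insert_of_notMem hj]
    push_cast
    constructor
    · obtain ⟨Q, hQ, hQP⟩ := Ideal.exists_minimalPrimes_le hIP
      have hprime := hQ.isPrime
      obtain ⟨hltQ, ha₀Q⟩ := hlt (Or.inl hQ) hQP
      exact (add_le_add_left (hc Q hprime ha₀Q (hmemI hQ.1.2)).1 1).trans
        (Ideal.height_add_one_le_of_lt_of_isPrime hltQ)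
    · intro hxP
      have hI'P : I' ≤ P := sup_le hIP ((Ideal.span_singleton_le_iff_mem P).mpr hxP)
      obtain ⟨Q, hQ, hQP⟩ := Ideal.exists_minimalPrimes_le hI'P
      have hprime := hQ.isPrime
      obtain ⟨hltQ, ha₀Q⟩ := hlt (Or.inr hQ) hQP
      have hxQ : x ∈ Q := hQ.1.2 (Ideal.mem_sup_right (Ideal.mem_span_singleton_self x))
      exact (add_le_add_left
        ((hc Q hprime ha₀Q (hmemI (le_sup_left.trans hQ.1.2))).2 hxQ) 1).trans
        (Ideal.height_add_one_le_of_lt_of_isPrime hltQ)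

end Avoidance

section Elementary

variable {R : Type*} [CommRing R] {n : Type*} [Fintype n] [DecidableEq n]

/-- `v` is obtained from `u` by right multiplication with a product of transvections. -/
def ElementaryEquiv (u v : n → R) : Prop :=
  ∃ ε ∈ Submonoid.closure {E : Matrix n n R |
    ∃ (i j : n) (c : R), i ≠ j ∧ E = Matrix.transvection i j c}, Matrix.vecMul u ε = v

namespace ElementaryEquiv

theorem refl (u : n → R) : ElementaryEquiv u u :=
  ⟨1, one_mem _, Matrix.vecMul_one u⟩

theorem trans {u v w : n → R} (h₁ : ElementaryEquiv u v) (h₂ : ElementaryEquiv v w) :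
    ElementaryEquiv u w := by
  obtain ⟨ε, hε, rfl⟩ := h₁
  obtain ⟨δ, hδ, rfl⟩ := h₂
  exact ⟨ε * δ, mul_mem hε hδ, (Matrix.vecMul_vecMul u ε δ).symm⟩

theorem update_add_mul (u : n → R) {i j : n} (hij : i ≠ j) (c : R) :
    ElementaryEquiv u (Function.update u j (u j + c * u i)) := by
  refine ⟨Matrix.transvection i j c, Submonoid.subset_closure ⟨i, j, c, hij, rfl⟩, ?_⟩
  ext k
  rw [Matrix.transvection, Matrix.vecMul_add, Matrix.vecMul_one]
  by_cases hk : k = j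
  · subst hk
    simp [Matrix.vecMul, dotProduct, Matrix.single_apply, mul_comm]
  · simp [Matrix.vecMul, dotProduct, hk, Ne.symm hk]

/-- Multiples of a fixed entry may be added to all other entries. -/
theorem add_mul_entry (u c : n → R) (k : n) :
    ElementaryEquiv u (fun i => if i = k then u k else u i + c i * u k) := by
  suffices h : ∀ s : Finset n, k ∉ s →
      ElementaryEquiv u (fun i => if i ∈ s then u i + c i * u k else u i) by
    convert h (Finset.univ.erase k) (by simp) using 2 with i
    by_cases hi : i = k <;> simp [hi]
  intro s
  induction s using Finset.induction_on with
  | empty => exact fun _ => by simpa using refl u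
  | insert j s hj ih =>
    intro hk
    simp only [Finset.mem_insert, not_or] at hk
    refine (ih hk.2).trans ?_
    convert update_add_mul _ hk.1 (c j) using 1
    ext i
    by_cases hi : i = j
    · subst hi; simp [hj, hk.2]
    · simp [hi]

/-- A linear combination of the other entries may be added to a fixed entry. -/
theorem update_add_sum (u c : n → R) (k : n) (s : Finset n) (hk : k ∉ s) :
    ElementaryEquiv u (Function.update u k (u k + ∑ i ∈ s, c i * u i)) := by
  induction s using Finset.induction_on with
  | empty => simpa using refl u
  | insert j s hj ih =>
    simp only [Finset.mem_insert, not_or] at hk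
    refine (ih hk.2).trans ?_
    convert update_add_mul _ (Ne.symm hk.1) (c j) using 1
    rw [Finset.sum_insert hj]
    simp [Ne.symm hk.1]
    ring_nf

end ElementaryEquiv

end Elementary

section AwayExtension

variable {B C : Type*} [CommRing B] [CommRing C] [Algebra B C]

/-- If `B ⊆ C` become equal after inverting `x ∈ B`, then primes of `B` not containing `x` are
contracted from primes of `C` of the same height. -/
theorem Ideal.exists_under_eq_and_height_eq (hinj : Function.Injective (algebraMap B C)) (x : B)
    (hx : ∀ c : C, ∃ (k : ℕ) (b : B), (algebraMap B C x) ^ k * c = algebraMap B C b)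
    (p : Ideal B) [hp : p.IsPrime] (hxp : x ∉ p) :
    ∃ P : Ideal C, P.IsPrime ∧ P.under B = p ∧ P.height = p.height := by
  let L := Localization.Away (algebraMap B C x)
  have hunit : IsUnit (algebraMap C L (algebraMap B C x)) :=
    IsLocalization.Away.algebraMap_isUnit _
  have hL : IsLocalization (Submonoid.powers x) L := by
    constructor
    constructor
    · rintro ⟨_, k, rfl⟩
      simp only [map_pow, IsScalarTower.algebraMap_apply B C L]
      exact hunit.pow k
    · intro z
      obtain ⟨⟨c, ⟨_, k, rfl⟩⟩, hz⟩ :=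
        IsLocalization.surj (Submonoid.powers (algebraMap B C x)) z
      obtain ⟨m, b, hb⟩ := hx c
      refine ⟨⟨b, ⟨x ^ (m + k), _, rfl⟩⟩, ?_⟩
      simp only [map_pow, IsScalarTower.algebraMap_apply B C L] at hz ⊢
      rw [← hb, map_mul, ← hz, map_pow]
      ring
    · intro b₁ b₂ h
      rw [IsScalarTower.algebraMap_apply B C L, IsScalarTower.algebraMap_apply B C L] at h
      obtain ⟨⟨_, k, rfl⟩, hk⟩ :=
        (IsLocalization.eq_iff_exists (Submonoid.powers (algebraMap B C x)) L).mp h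
      refine ⟨⟨x ^ k, k, rfl⟩, hinj ?_⟩
      simpa using hk
  have hdisj : Disjoint (Submonoid.powers x : Set B) (p : Set B) := by
    rw [Set.disjoint_left]
    rintro _ ⟨k, rfl⟩ h
    exact hxp (hp.mem_of_pow_mem k h)
  have hprime := IsLocalization.isPrime_of_isPrime_disjoint _ L p hp hdisj
  refine ⟨(p.map (algebraMap B L)).under C, inferInstance, ?_, ?_⟩
  · rw [Ideal.under_under, IsLocalization.under_map_of_isPrime_disjoint _ L hp hdisj]
  · rw [IsLocalization.height_under (Submonoid.powers (algebraMap B C x)),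
      IsLocalization.height_map_of_disjoint (Submonoid.powers x) p hdisj]

/-- Suppose `B ⊆ C` become equal after inverting `x ∈ B`, and `J` is an ideal of `C` comaximal with
`x` all of whose prime overideals have height at least `dim B`. Then `J ∩ B` is comaximal with `x`. -/
theorem Ideal.under_sup_span_singleton_eq_top (hinj : Function.Injective (algebraMap B C)) (x : B)
    (hx : ∀ c : C, ∃ (k : ℕ) (b : B), (algebraMap B C x) ^ k * c = algebraMap B C b)
    {d : ℕ} (hdB : ringKrullDim B ≤ d) (J : Ideal C)
    (hJx : J ⊔ Ideal.span {algebraMap B C x} = ⊤)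
    (hJ : ∀ P : Ideal C, P.IsPrime → J ≤ P → (d : ℕ∞) ≤ P.height) :
    J.under B ⊔ Ideal.span {x} = ⊤ := by
  by_contra hne
  obtain ⟨m, hm, hle⟩ := Ideal.exists_le_maximal _ hne
  have hxm : x ∈ m := hle (Ideal.mem_sup_right (Ideal.mem_span_singleton_self x))
  obtain ⟨p, hp, hpm⟩ := Ideal.exists_minimalPrimes_le (le_sup_left.trans hle)
  have hprime := hp.isPrime
  have hxp : x ∉ p := by
    intro hxp
    obtain ⟨y, hy, hxy⟩ := Ideal.exists_mul_mem_of_mem_minimalPrimes hp hxp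
    obtain ⟨c, j, hj, hc⟩ := Ideal.mem_span_singleton_sup.mp
      ((Ideal.eq_top_iff_one _).mp (sup_comm J _ ▸ hJx))
    refine hy (Ideal.mem_comap.mpr ?_)
    have hxy' : algebraMap B C x * algebraMap B C y ∈ J := by
      rw [← map_mul]
      exact hxy
    have hy_eq : algebraMap B C y =
        j * algebraMap B C y + c * (algebraMap B C x * algebraMap B C y) := by
      linear_combination -algebraMap B C y * hc
    rw [hy_eq]
    exact J.add_mem (J.mul_mem_right _ hj) (J.mul_mem_left _ hxy')
  obtain ⟨P, hP, hPp, hht⟩ := Ideal.exists_under_eq_and_height_eq hinj x hx p hxp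
  have hJP : J ≤ P := by
    intro j hj
    obtain ⟨k, b, hb⟩ := hx j
    have hbP : algebraMap B C b ∈ P := by
      rw [← Ideal.mem_comap, ← Ideal.under_def, hPp]
      refine hp.1.2 ?_
      rw [Ideal.under_def, Ideal.mem_comap, ← hb]
      exact J.mul_mem_left _ hj
    rw [← hb] at hbP
    refine (hP.mem_or_mem hbP).resolve_left fun h => hxp ?_
    rw [← hPp]
    exact hP.mem_of_pow_mem k h
  have hpm' : p < m := lt_of_le_of_ne hpm fun h => hxp (h ▸ hxm)
  have h₁ : (d : ℕ∞) + 1 ≤ m.height :=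
    (add_le_add_left ((hJ P hP hJP).trans_eq hht) 1).trans
      (Ideal.height_add_one_le_of_lt_of_isPrime hpm')
  have h₂ : m.height ≤ (d : ℕ∞) := by
    exact_mod_cast (Ideal.height_le_ringKrullDim_of_isPrime (I := m)).trans hdB
  exact absurd (h₁.trans h₂) (by simpa using ENat.natCast_lt_natCast.mpr (Nat.lt_succ_self d))

end AwayExtension

theorem stmt_7 {B C : Type*} [CommRing B] [CommRing C]
    [IsNoetherianRing B] [IsNoetherianRing C] [IsReduced B] [IsReduced C] [Algebra B C]
    (hinj : Function.Injective (algebraMap B C)) (d : ℕ) (hd : 1 ≤ d)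
    (hdB : ringKrullDim B = (d : ℕ)) (hdC : ringKrullDim C = (d : ℕ))
    (x : B) (hxC : algebraMap B C x ∈ nonZeroDivisors C)
    (hx : ∀ c : C, ∃ (k : ℕ) (b : B), (algebraMap B C x) ^ k * c = algebraMap B C b)
    (u : Fin (d + 1) → C) (hu : Ideal.span (Set.range u) = ⊤) :
    ∃ ε ∈ Submonoid.closure {E : Matrix (Fin (d + 1)) (Fin (d + 1)) C |
        ∃ (i j : Fin (d + 1)) (c : C), i ≠ j ∧ E = Matrix.transvection i j c},
      ∃ v : Fin (d + 1) → B,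
        (∀ i, algebraMap B C (v i) = Matrix.vecMul u ε i) ∧
        Ideal.span (Set.range v) = ⊤ := by
  set φ := algebraMap B C with hφ
  have hnotmem (P : Ideal C) (hP : P.IsPrime) (h : ∀ i, u i ∈ P) : False :=
    hP.ne_top (top_unique (hu ▸ Ideal.span_le.mpr (Set.range_subset_iff.mpr h)))
  obtain ⟨c, hc⟩ := Ideal.exists_add_mul_card_le_height (u 0) hxC u (Finset.univ.erase 0)
  simp only [Finset.card_erase_of_mem (Finset.mem_univ _), Finset.card_univ, Fintype.card_fin,
    Nat.add_sub_cancel] at hc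
  set a : Fin (d + 1) → C := fun i => u i + c i * u 0 with ha
  set J : Ideal C := Ideal.span (a '' (Finset.univ.erase 0 : Finset (Fin (d + 1)))) with hJ
  have haJ (i : Fin (d + 1)) (hi : i ≠ 0) : a i ∈ J := Ideal.subset_span ⟨i, by simpa using hi, rfl⟩
  have hu₀ (P : Ideal C) (hP : P.IsPrime) (hPa : ∀ i ≠ 0, a i ∈ P) : u 0 ∉ P := by
    refine fun h₀ => hnotmem P hP fun i => ?_
    by_cases hi : i = 0
    · exact hi ▸ h₀
    · exact (Ideal.add_mem_iff_left _ (P.mul_mem_left _ h₀)).mp (hPa i hi)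
  have hJP (P : Ideal C) (hP : P.IsPrime) (hle : J ≤ P) :=
    hc P hP (hu₀ P hP fun i hi => hle (haJ i hi)) fun i hi => hle (haJ i (Finset.ne_of_mem_erase hi))
  have hJx : J ⊔ Ideal.span {φ x} = ⊤ := by
    by_contra hne
    obtain ⟨P, hP, hle⟩ := Ideal.exists_le_maximal _ hne
    have h₁ := (hJP P hP.isPrime (le_sup_left.trans hle)).2
      (hle (Ideal.mem_sup_right (Ideal.mem_span_singleton_self _)))
    have h₂ : P.height ≤ (d : ℕ∞) := by
      exact_mod_cast (Ideal.height_le_ringKrullDim_of_isPrime (I := P)).trans hdC.le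
    exact absurd (h₁.trans h₂) (by simpa using ENat.natCast_lt_natCast.mpr (Nat.lt_succ_self d))
  have hBx := Ideal.under_sup_span_singleton_eq_top hinj x hx hdB.le J hJx
    fun P hP hle => (hJP P hP hle).1
  -- The entry `u 0` may be changed modulo `J` into an element of `1 + xB`.
  obtain ⟨r, hr⟩ : ∃ r : B, φ (1 - x * r) - u 0 ∈ J := by
    obtain ⟨k, b, hb⟩ := hx (u 0)
    have hcop : IsCoprime (J.under B) (Ideal.span {x}) := Ideal.isCoprime_iff_sup_eq.mpr hBx
    have hcopk : J.under B ⊔ Ideal.span {x ^ k} = ⊤ := by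
      rw [← Ideal.span_singleton_pow]
      exact Ideal.isCoprime_iff_sup_eq.mp hcop.pow_right
    obtain ⟨t₁, j₁, hj₁, ht₁⟩ :=
      Ideal.mem_span_singleton_sup.mp ((Ideal.eq_top_iff_one _).mp (sup_comm (J.under B) _ ▸ hBx))
    obtain ⟨t₂, j₂, hj₂, ht₂⟩ :=
      Ideal.mem_span_singleton_sup.mp ((Ideal.eq_top_iff_one _).mp (sup_comm (J.under B) _ ▸ hcopk))
    refine ⟨t₁ * (1 - t₂ * b), ?_⟩
    have ht₁' := congrArg φ ht₁
    have ht₂' := congrArg φ ht₂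
    simp only [map_add, map_mul, map_pow, map_one] at ht₁' ht₂'
    have heq : φ (1 - x * (t₁ * (1 - t₂ * b))) - u 0 =
        (1 - φ t₂ * φ b) * φ j₁ - u 0 * φ j₂ := by
      simp only [map_sub, map_mul, map_one]
      linear_combination (φ t₂ * φ b - 1) * ht₁' + u 0 * ht₂' - φ t₂ * hb
    rw [heq]
    exact J.sub_mem (J.mul_mem_left _ hj₁) (J.mul_mem_left _ hj₂)
  obtain ⟨l, hl⟩ : ∃ l : Fin (d + 1) → C,
      ∑ i ∈ Finset.univ.erase 0, l i * a i = φ (1 - x * r) - u 0 := by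
    simpa only [smul_eq_mul] using (Submodule.mem_span_image_finset_iff_exists_fun' C).mp hr
  -- As `x` is invertible modulo `1 - x * r`, the map `B → C/(1 - x * r)` is surjective.
  have hq (y : C) : ∃ (q : C) (b : B), y + q * φ (1 - x * r) = φ b := by
    obtain ⟨k, b, hb⟩ := hx y
    obtain ⟨s, t, hst⟩ : IsCoprime (x ^ k) (1 - x * r) :=
      IsCoprime.pow_left ⟨r, 1, by ring⟩
    refine ⟨-(y * φ t), s * b, ?_⟩
    have hst' := congrArg φ hst
    simp only [map_add, map_mul, map_pow, map_one] at hst'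
    rw [map_mul, ← hb]
    linear_combination -y * hst'
  choose q b hqb using fun i => hq (a i)
  let v : Fin (d + 1) → B := fun i => if i = 0 then 1 - x * r else b i
  have hequiv : ElementaryEquiv u (fun i => φ (v i)) := by
    refine (ElementaryEquiv.add_mul_entry u c 0).trans
      ((ElementaryEquiv.update_add_sum _ l 0 (Finset.univ.erase 0) (by simp)).trans ?_)
    convert ElementaryEquiv.add_mul_entry _ q 0 using 1
    have hsum : ∑ i ∈ Finset.univ.erase 0,
        l i * (if i = 0 then u 0 else u i + c i * u 0) = φ (1 - x * r) - u 0 := by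
      rw [← hl]
      exact Finset.sum_congr rfl fun i hi => by rw [if_neg (Finset.ne_of_mem_erase hi)]
    ext i
    by_cases hi : i = 0
    · simp only [hi, v, if_true, Function.update_self, hsum]
      ring
    · simp only [hi, v, if_false, if_true, Function.update_self, hsum, ne_eq, not_false_eq_true,
        Function.update_of_ne, ← hqb, ha]
      ring
  obtain ⟨ε, hε, hεv⟩ := hequiv
  refine ⟨ε, hε, v, fun i => (congrFun hεv i).symm, ?_⟩
  by_contra hne
  obtain ⟨m, hm, hle⟩ := Ideal.exists_le_maximal _ hne
  have hvm (i : Fin (d + 1)) : v i ∈ m := hle (Ideal.subset_span ⟨i, rfl⟩)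
  have hw : 1 - x * r ∈ m := by simpa [v] using hvm 0
  have hxm : x ∉ m := fun h => hm.ne_top <| (Ideal.eq_top_iff_one _).mpr <| by
    simpa using m.add_mem hw (m.mul_mem_right r h)
  obtain ⟨P, hP, hPm, -⟩ := Ideal.exists_under_eq_and_height_eq hinj x hx m hxm
  have hφP {y : B} (hy : y ∈ m) : φ y ∈ P := by
    rwa [← hPm] at hy
  have haP (i : Fin (d + 1)) (hi : i ≠ 0) : a i ∈ P := by
    have hbm : b i ∈ m := by simpa [v, hi] using hvm i
    have hbP := hφP hbm
    rw [← hqb] at hbP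
    exact (Ideal.add_mem_iff_left _ (P.mul_mem_left _ (hφP hw))).mp hbP
  refine hu₀ P hP haP ?_
  have hJleP : J ≤ P := by
    rw [hJ, Ideal.span_le]
    rintro _ ⟨i, hi, rfl⟩
    exact haP i (by simpa using hi)
  simpa using P.sub_mem (hφP hw) (hJleP hr)
end

section
/- Let R be a commutative Noetherian ring of Krull dimension d ≥ 1 and let s ∈ R be a non-zero divisor such that dim(R_s) ≤ d − 1. Then there exists a generalized dimension function δ : Spec(R) → ℕ such that δ(p) ≤ d − 1 for all p ∈ Spec(R). -/
/-- `δ` is a generalized dimension function on the subset `S` of `Spec R`: for every ideal `I`,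
the set `V(I) ∩ S` has only finitely many minimal elements with respect to the partial order
`p << q ↔ p ⊆ q ∧ δ p > δ q`. -/
def IsGenDimFun {R : Type*} [CommRing R] (S : Set (PrimeSpectrum R))
    (δ : PrimeSpectrum R → ℕ) : Prop :=
  ∀ I : Ideal R,
    Set.Finite {q | q ∈ PrimeSpectrum.zeroLocus (I : Set R) ∩ S ∧
      ∀ p ∈ PrimeSpectrum.zeroLocus (I : Set R) ∩ S, ¬(p.asIdeal ≤ q.asIdeal ∧ δ q < δ p)}

theorem exists_strictAnti_nat_of_krullDim_le {α : Type*} [PartialOrder α] (n : ℕ)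
    (h : Order.krullDim α ≤ (n : WithBot ℕ∞)) :
    ∃ f : α → ℕ, StrictAnti f ∧ ∀ a, f a ≤ n := by
  have hle (a : α) : Order.coheight a ≤ (n : ℕ∞) :=
    WithBot.coe_le_coe.mp ((Order.coheight_le_krullDim a).trans h)
  have hlt (a : α) : Order.coheight a < ⊤ := (hle a).trans_lt (ENat.natCast_lt_top n)
  refine ⟨fun a => (Order.coheight a).toNat, fun a b hab => ?_, fun a => ?_⟩
  · have hc := Order.coheight_strictAnti hab (hlt b)
    rw [← ENat.natCast_toNat (hlt a).ne, ← ENat.natCast_toNat (hlt b).ne] at hc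
    exact_mod_cast hc
  · exact ENat.toNat_le_of_le_natCast (hle a)

theorem isGenDimFun_univ_of_strictAnti {R : Type*} [CommRing R] [IsNoetherianRing R] (s : R)
    (δ : PrimeSpectrum R → ℕ)
    (hmem : ∀ p q : PrimeSpectrum R, s ∈ p.asIdeal → p < q → δ q < δ p)
    (hnotMem : ∀ p q : PrimeSpectrum R, s ∉ q.asIdeal → p < q → δ q < δ p) :
    IsGenDimFun Set.univ δ := by
  intro I
  have hfin (J : Ideal R) : {q : PrimeSpectrum R | q.asIdeal ∈ J.minimalPrimes}.Finite :=
    (J.finite_minimalPrimes_of_isNoetherianRing R).preimage fun p _ q _ h =>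
      PrimeSpectrum.ext h
  have exists_lt (J : Ideal R) (q : PrimeSpectrum R) (hJq : J ≤ q.asIdeal)
      (hq : q.asIdeal ∉ J.minimalPrimes) : ∃ p : PrimeSpectrum R, J ≤ p.asIdeal ∧ p < q := by
    obtain ⟨p, hp, hpq⟩ := Ideal.exists_minimalPrimes_le hJq
    refine ⟨⟨p, hp.1.1⟩, hp.1.2, lt_of_le_of_ne hpq ?_⟩
    rintro rfl
    exact hq hp
  refine ((hfin I).union (hfin (I ⊔ Ideal.span {s}))).subset ?_
  rintro q ⟨⟨hIq, -⟩, hmin⟩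
  by_contra hq
  rw [Set.mem_union, not_or] at hq
  by_cases hs : s ∈ q.asIdeal
  · obtain ⟨p, hp, hpq⟩ := exists_lt _ q
      (sup_le hIq ((Ideal.span_singleton_le_iff_mem _).mpr hs)) hq.2
    rw [sup_le_iff, Ideal.span_singleton_le_iff_mem] at hp
    exact hmin p ⟨hp.1, trivial⟩ ⟨hpq.le, hmem p q hp.2 hpq⟩
  · obtain ⟨p, hp, hpq⟩ := exists_lt _ q hIq hq.1
    exact hmin p ⟨hp, trivial⟩ ⟨hpq.le, hnotMem p q hs hpq⟩

theorem stmt_9 {R : Type*} [CommRing R] [IsNoetherianRing R] (d : ℕ) (hd : 1 ≤ d)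
    (hdim : ringKrullDim R = (d : ℕ)) (s : R) (hs : s ∈ nonZeroDivisors R)
    (hds : ringKrullDim (Localization (Submonoid.powers s)) ≤ ((d - 1 : ℕ) : WithBot (WithTop ℕ))) :
    ∃ δ : PrimeSpectrum R → ℕ, IsGenDimFun Set.univ δ ∧ ∀ p, δ p ≤ d - 1 := by
  have hquot : ringKrullDim (R ⧸ Ideal.span {s}) ≤ ((d - 1 : ℕ) : WithBot ℕ∞) := by
    have h := ringKrullDim_quotient_succ_le_of_nonZeroDivisor hs
    rw [hdim, ← Nat.sub_add_cancel hd] at h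
    push_cast at h
    exact ENat.WithBot.add_le_add_one_right_iff.mp h
  rw [ringKrullDim_quotient] at hquot
  rw [ringKrullDim, Order.krullDim_eq_of_orderIso
    (IsLocalization.primeSpectrumOrderIso (Submonoid.powers s) _)] at hds
  obtain ⟨f, hf, hfd⟩ := exists_strictAnti_nat_of_krullDim_le _ hquot
  obtain ⟨g, hg, hgd⟩ := exists_strictAnti_nat_of_krullDim_le _ hds
  have hV (p : PrimeSpectrum R) :
      p ∈ PrimeSpectrum.zeroLocus (Ideal.span {s} : Set R) ↔ s ∈ p.asIdeal :=
    Ideal.span_singleton_le_iff_mem _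
  have hD (p : PrimeSpectrum R) :
      Disjoint (Submonoid.powers s : Set R) p.asIdeal ↔ s ∉ p.asIdeal :=
    Ideal.disjoint_powers_iff_notMem s p.isPrime.isRadical
  classical
  refine ⟨fun p => if h : s ∈ p.asIdeal then f ⟨p, (hV p).mpr h⟩ else g ⟨p, (hD p).mpr h⟩,
    isGenDimFun_univ_of_strictAnti s _ (fun p q hp hpq => ?_) (fun p q hq hpq => ?_),
    fun p => ?_⟩
  · have hq : s ∈ q.asIdeal := hpq.le hp
    simp only [hp, hq, dite_true]
    exact hf hpq
  · have hp : s ∉ p.asIdeal := fun h => hq (hpq.le h)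
    simp only [hp, hq, dite_false]
    exact hg hpq
  · dsimp only
    split_ifs
    · exact hfd _
    · exact hgd _
end

section
/- Let R be a commutative Noetherian ring. Let M be a finitely generated R[T]-module and N a finitely generated projective R-module. Let α(T), β(T) : M ↠ N[T] be surjective R[T]-linear maps such that α(0) = β(0), where α(0), β(0) denote the induced maps M/TM → N obtained by reduction modulo T. Assume further that the R[T]-modules ker(α(T)) and ker(β(T)) are extended from the base ring R. Then there exists an automorphism Γ(T) of the R[T]-module M such that Γ(0) = Id (i.e., Γ induces the identity on M/TM) and α(T) = β(T) ∘ Γ(T). -/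
open Polynomial

universe v

/-- A module `N` over `S` is extended along the ring map `φ : R₀ →+* S` if `N ≅ S ⊗[R₀] N₀`
for some `R₀`-module `N₀`. -/
def IsExtendedAlong {R₀ S : Type*} [CommRing R₀] [CommRing S] (φ : R₀ →+* S)
    (N : Type v) [AddCommGroup N] [Module S N] : Prop :=
  ∃ (N₀ : Type v) (_ : AddCommGroup N₀) (_ : Module R₀ N₀),
    letI : Algebra R₀ S := φ.toAlgebra
    Nonempty ((TensorProduct R₀ S N₀) ≃ₗ[S] N)

open TensorProduct in
/-- The evaluation `R[X] ⊗ A → A` at `X = 0`. -/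
noncomputable def evalZeroTensor (R A : Type*) [CommRing R] [AddCommGroup A] [Module R A] :
    R[X] ⊗[R] A →ₗ[R] A :=
  (TensorProduct.lid R A).toLinearMap ∘ₗ (Polynomial.lcoeff R 0).rTensor A

section

open TensorProduct

variable {R A B : Type*} [CommRing R] [AddCommGroup A] [Module R A] [AddCommGroup B] [Module R B]

theorem evalZeroTensor_tmul (p : R[X]) (a : A) :
    evalZeroTensor R A (p ⊗ₜ a) = p.coeff 0 • a := by
  simp [evalZeroTensor]

theorem evalZeroTensor_X_smul (z : R[X] ⊗[R] A) :
    evalZeroTensor R A ((X : R[X]) • z) = 0 := by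
  induction z using TensorProduct.induction_on with
  | zero => simp
  | tmul p a => simp [TensorProduct.smul_tmul', evalZeroTensor_tmul]
  | add x y hx hy => rw [smul_add, map_add, hx, hy, add_zero]

theorem exists_sub_one_tmul_evalZeroTensor (z : R[X] ⊗[R] A) :
    ∃ w, z - 1 ⊗ₜ[R] evalZeroTensor R A z = (X : R[X]) • w := by
  induction z using TensorProduct.induction_on with
  | zero => exact ⟨0, by simp⟩
  | tmul p a =>
    refine ⟨p.divX ⊗ₜ a, ?_⟩
    rw [evalZeroTensor_tmul, ← TensorProduct.smul_tmul, ← TensorProduct.sub_tmul,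
      TensorProduct.smul_tmul', smul_eq_mul]
    congr 1
    nth_rewrite 1 [← Polynomial.X_mul_divX_add p]
    rw [Polynomial.smul_eq_C_mul, mul_one, add_sub_cancel_right]
  | add x y hx hy =>
    obtain ⟨u, hu⟩ := hx
    obtain ⟨v, hv⟩ := hy
    exact ⟨u + v, by rw [smul_add, ← hu, ← hv, map_add, TensorProduct.tmul_add]; abel⟩

/-- The reduction modulo `X` of a linear map between modules extended from `R`. -/
noncomputable def reductionModX (f : R[X] ⊗[R] A →ₗ[R[X]] R[X] ⊗[R] B) : A →ₗ[R] B :=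
  evalZeroTensor R B ∘ₗ f.restrictScalars R ∘ₗ TensorProduct.mk R R[X] A 1

theorem reductionModX_comp_eq_id (f : R[X] ⊗[R] A →ₗ[R[X]] R[X] ⊗[R] B)
    (g : R[X] ⊗[R] B →ₗ[R[X]] R[X] ⊗[R] A)
    (h : ∀ z, ∃ w, g (f z) - z = (X : R[X]) • w) :
    reductionModX g ∘ₗ reductionModX f = LinearMap.id := by
  ext a
  obtain ⟨w, hw⟩ := exists_sub_one_tmul_evalZeroTensor (f (1 ⊗ₜ a))
  obtain ⟨u, hu⟩ := h (1 ⊗ₜ a)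
  change evalZeroTensor R A (g (1 ⊗ₜ evalZeroTensor R B (f (1 ⊗ₜ a)))) = a
  rw [← sub_sub_self (f (1 ⊗ₜ a)) (1 ⊗ₜ evalZeroTensor R B (f (1 ⊗ₜ a))), hw, map_sub,
    map_smul, map_sub, evalZeroTensor_X_smul, sub_zero, sub_eq_iff_eq_add.mp hu, map_add,
    evalZeroTensor_X_smul, zero_add, evalZeroTensor_tmul]
  simp

/-- A linear map between modules extended from `R` which is invertible modulo `X` is congruent
modulo `X` to an isomorphism. -/
theorem exists_equiv_congr_mod_X (f : R[X] ⊗[R] A →ₗ[R[X]] R[X] ⊗[R] B)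
    (g : R[X] ⊗[R] B →ₗ[R[X]] R[X] ⊗[R] A)
    (hgf : ∀ z, ∃ w, g (f z) - z = (X : R[X]) • w)
    (hfg : ∀ z, ∃ w, f (g z) - z = (X : R[X]) • w) :
    ∃ θ : R[X] ⊗[R] A ≃ₗ[R[X]] R[X] ⊗[R] B, ∀ z, ∃ w, θ z - f z = (X : R[X]) • w := by
  let e : A ≃ₗ[R] B := LinearEquiv.ofLinearMap (reductionModX f) (reductionModX g)
    (reductionModX_comp_eq_id g f hfg) (reductionModX_comp_eq_id f g hgf)
  refine ⟨e.baseChange R R[X] A B, fun z => ?_⟩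
  induction z using TensorProduct.induction_on with
  | zero => exact ⟨0, by simp⟩
  | tmul p a =>
    obtain ⟨w, hw⟩ := exists_sub_one_tmul_evalZeroTensor (f (1 ⊗ₜ a))
    refine ⟨-(p • w), ?_⟩
    have he : e.baseChange R R[X] A B (1 ⊗ₜ a) = 1 ⊗ₜ evalZeroTensor R B (f (1 ⊗ₜ a)) := rfl
    have hp : p ⊗ₜ[R] a = p • ((1 : R[X]) ⊗ₜ[R] a) := by
      rw [TensorProduct.smul_tmul', smul_eq_mul, mul_one]
    rw [hp, map_smul, map_smul, he]
    refine (smul_sub p ((1 : R[X]) ⊗ₜ[R] evalZeroTensor R B (f (1 ⊗ₜ a)))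
      (f (1 ⊗ₜ a))).symm.trans ?_
    rw [← neg_sub, hw, smul_neg, smul_neg, smul_comm]
  | add x y hx hy =>
    obtain ⟨u, hu⟩ := hx
    obtain ⟨v, hv⟩ := hy
    exact ⟨u + v, by rw [smul_add, ← hu, ← hv, map_add, map_add]; abel⟩

theorem IsExtendedAlong.exists_equiv {S : Type*} [CommRing S] [j : Algebra R S]
    {K : Type v} [AddCommGroup K] [Module S K] (h : IsExtendedAlong (algebraMap R S) K) :
    ∃ (K₀ : Type v) (_ : AddCommGroup K₀) (_ : Module R K₀),
      Nonempty ((S ⊗[R] K₀) ≃ₗ[S] K) := by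
  have key (i : Algebra R S) (hi : i = j)
      (h' : ∃ (K₀ : Type v) (_ : AddCommGroup K₀) (_ : Module R K₀),
        letI := i
        Nonempty ((S ⊗[R] K₀) ≃ₗ[S] K)) :
      ∃ (K₀ : Type v) (_ : AddCommGroup K₀) (_ : Module R K₀),
        letI := j
        Nonempty ((S ⊗[R] K₀) ≃ₗ[S] K) := by
    subst hi
    exact h'
  exact key (algebraMap R S).toAlgebra (Algebra.algebra_ext _ _ fun _ => rfl) h

theorem IsExtendedAlong.exists_equiv_congr_mod_X {K L : Type*} [AddCommGroup K] [Module R[X] K]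
    [AddCommGroup L] [Module R[X] L] (hK : IsExtendedAlong (algebraMap R R[X]) K)
    (hL : IsExtendedAlong (algebraMap R R[X]) L) (f : K →ₗ[R[X]] L) (g : L →ₗ[R[X]] K)
    (hgf : ∀ z, ∃ w, g (f z) - z = (X : R[X]) • w)
    (hfg : ∀ z, ∃ w, f (g z) - z = (X : R[X]) • w) :
    ∃ θ : K ≃ₗ[R[X]] L, ∀ z, ∃ w, θ z - f z = (X : R[X]) • w := by
  obtain ⟨K₀, _, _, ⟨a⟩⟩ := hK.exists_equiv
  obtain ⟨L₀, _, _, ⟨b⟩⟩ := hL.exists_equiv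
  obtain ⟨θ, hθ⟩ := _root_.exists_equiv_congr_mod_X
    (b.symm.toLinearMap ∘ₗ f ∘ₗ a.toLinearMap) (a.symm.toLinearMap ∘ₗ g ∘ₗ b.toLinearMap)
    (fun z => by
      obtain ⟨w, hw⟩ := hgf (a z)
      exact ⟨a.symm w, by rw [← map_smul, ← hw]; simp⟩)
    (fun z => by
      obtain ⟨w, hw⟩ := hfg (b z)
      exact ⟨b.symm w, by rw [← map_smul, ← hw]; simp⟩)
  refine ⟨a.symm ≪≫ₗ θ ≪≫ₗ b, fun z => ?_⟩
  obtain ⟨w, hw⟩ := hθ (a.symm z)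
  exact ⟨b w, by rw [← map_smul, ← hw]; simp⟩

end

section

variable {S M P : Type*} [CommRing S] [AddCommGroup M] [Module S M] [AddCommGroup P] [Module S P]

theorem mem_span_singleton_smul_top_iff (x : S) (m : M) :
    m ∈ Ideal.span {x} • (⊤ : Submodule S M) ↔ ∃ y, m = x • y := by
  rw [Submodule.ideal_span_singleton_smul, Submodule.mem_smul_pointwise_iff_exists]
  simp [eq_comm]

/-- The projection onto the kernel of `α` along a section `s`. -/
def projKer (α : M →ₗ[S] P) (s : P →ₗ[S] M) (h : ∀ p, α (s p) = p) :
    M →ₗ[S] LinearMap.ker α :=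
  (LinearMap.id - s ∘ₗ α).codRestrict _ fun m => by simp [h]

theorem coe_projKer (α : M →ₗ[S] P) (s : P →ₗ[S] M) (h : ∀ p, α (s p) = p) (m : M) :
    (projKer α s h m : M) = m - s (α m) := rfl

theorem projKer_comp_sub_mem (x : S) (α β : M →ₗ[S] P) (s t : P →ₗ[S] M)
    (hs : ∀ p, α (s p) = p) (ht : ∀ p, β (t p) = p) (h0 : ∀ m, ∃ p, α m - β m = x • p)
    (k : LinearMap.ker α) :
    ∃ w, projKer α s hs (projKer β t ht k) - k = x • w := by
  obtain ⟨p, hp⟩ := h0 k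
  refine ⟨projKer α s hs (t p), ?_⟩
  have hk : α k = 0 := k.2
  have hβ : β k = -(x • p) := by rw [← hp, hk]; abel
  ext
  simp [coe_projKer, hβ, hk, smul_sub]

/-- Surjections onto a projective module that agree modulo `x` have sections that agree
modulo `x`. -/
theorem exists_sections_congr [Module.Projective S P] (x : S) (α β : M →ₗ[S] P)
    (hα : Function.Surjective α) (hβ : Function.Surjective β)
    (h0 : ∀ m, ∃ p, α m - β m = x • p) :
    ∃ s t : P →ₗ[S] M, (∀ p, α (s p) = p) ∧ (∀ p, β (t p) = p) ∧
      ∀ p, ∃ m, t p - s p = x • m := by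
  obtain ⟨t, ht⟩ := Module.projective_lifting_property β LinearMap.id hβ
  replace ht : ∀ p, β (t p) = p := LinearMap.congr_fun ht
  let xM := LinearMap.range (LinearMap.lsmul S M x)
  let xP := LinearMap.range (LinearMap.lsmul S P x)
  let q : xM →ₗ[S] xP := α.restrict (by rintro _ ⟨m, rfl⟩; exact ⟨α m, by simp⟩)
  have hq : Function.Surjective q := by
    rintro ⟨_, p, rfl⟩
    obtain ⟨m, rfl⟩ := hα p
    exact ⟨⟨x • m, m, rfl⟩, Subtype.ext (by simp [q])⟩
  obtain ⟨δ, hδ⟩ := Module.projective_lifting_property q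
    ((LinearMap.id - α ∘ₗ t).codRestrict xP fun p => by
      obtain ⟨r, hr⟩ := h0 (t p)
      refine ⟨-r, ?_⟩
      rw [LinearMap.lsmul_apply, smul_neg, ← hr, ht]
      simp) hq
  have hδ' (p : P) : α (δ p) = p - α (t p) := congrArg Subtype.val (LinearMap.congr_fun hδ p)
  refine ⟨t + xM.subtype ∘ₗ δ, t, fun p => by simp [hδ'], ht, fun p => ?_⟩
  obtain ⟨m, hm⟩ := (δ p).2
  exact ⟨-m, by rw [smul_neg]; simpa using hm.symm⟩

/-- Split surjections whose kernels are isomorphic differ by an automorphism of the source. -/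
theorem exists_equiv_of_ker_equiv (α β : M →ₗ[S] P) (s t : P →ₗ[S] M)
    (hs : ∀ p, α (s p) = p) (ht : ∀ p, β (t p) = p) (θ : LinearMap.ker α ≃ₗ[S] LinearMap.ker β) :
    ∃ Γ : M ≃ₗ[S] M, ∀ m, Γ m = θ (projKer α s hs m) + t (α m) := by
  have hα (k : LinearMap.ker α) : α k = 0 := k.2
  have hβ (k : LinearMap.ker β) : β k = 0 := k.2
  have key₁ (k : LinearMap.ker α) (p : P) : projKer α s hs (k + s p) = k := by
    ext; simp [coe_projKer, hs, hα]
  have key₂ (k : LinearMap.ker β) (p : P) : projKer β t ht (k + t p) = k := by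
    ext; simp [coe_projKer, ht, hβ]
  refine ⟨LinearEquiv.ofLinearMap
    ((LinearMap.ker β).subtype ∘ₗ θ.toLinearMap ∘ₗ projKer α s hs + t ∘ₗ α)
    ((LinearMap.ker α).subtype ∘ₗ θ.symm.toLinearMap ∘ₗ projKer β t ht + s ∘ₗ β) ?_ ?_,
    fun m => rfl⟩
  · ext m
    change (θ (projKer α s hs (θ.symm (projKer β t ht m) + s (β m))) : M) +
      t (α (θ.symm (projKer β t ht m) + s (β m))) = m
    rw [key₁, θ.apply_symm_apply, map_add, hα, hs, coe_projKer]
    simp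
  · ext m
    change (θ.symm (projKer β t ht (θ (projKer α s hs m) + t (α m))) : M) +
      s (β (θ (projKer α s hs m) + t (α m))) = m
    rw [key₂, θ.symm_apply_apply, map_add, hβ, ht, coe_projKer]
    simp

end

theorem stmt_10 {R : Type*} [CommRing R] [IsNoetherianRing R]
    (M : Type v) [AddCommGroup M] [Module (Polynomial R) M] [Module.Finite (Polynomial R) M]
    (N : Type*) [AddCommGroup N] [Module R N] [Module.Finite R N] [Module.Projective R N]
    (α β : M →ₗ[Polynomial R] TensorProduct R (Polynomial R) N)
    (hα : Function.Surjective α) (hβ : Function.Surjective β)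
    (h0 : ∀ m : M, α m - β m ∈ (Ideal.span {(X : Polynomial R)}) •
      (⊤ : Submodule (Polynomial R) (TensorProduct R (Polynomial R) N)))
    (hkα : IsExtendedAlong (algebraMap R (Polynomial R)) (LinearMap.ker α))
    (hkβ : IsExtendedAlong (algebraMap R (Polynomial R)) (LinearMap.ker β)) :
    ∃ Γ : M ≃ₗ[Polynomial R] M,
      (∀ m : M, Γ m - m ∈ (Ideal.span {(X : Polynomial R)}) •
        (⊤ : Submodule (Polynomial R) M)) ∧
      ∀ m : M, α m = β (Γ m) := by
  simp only [mem_span_singleton_smul_top_iff] at h0 ⊢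
  have h0' (m : M) : ∃ p, β m - α m = (X : R[X]) • p := by
    obtain ⟨p, hp⟩ := h0 m
    exact ⟨-p, by rw [smul_neg, ← hp, neg_sub]⟩
  obtain ⟨s, t, hs, ht, hst⟩ := exists_sections_congr (X : R[X]) α β hα hβ h0
  obtain ⟨θ, hθ⟩ := hkα.exists_equiv_congr_mod_X hkβ
    (projKer β t ht ∘ₗ (LinearMap.ker α).subtype) (projKer α s hs ∘ₗ (LinearMap.ker β).subtype)
    (projKer_comp_sub_mem X α β s t hs ht h0) (projKer_comp_sub_mem X β α t s ht hs h0')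
  obtain ⟨Γ, hΓ⟩ := exists_equiv_of_ker_equiv α β s t hs ht θ
  refine ⟨Γ, fun m => ?_, fun m => ?_⟩
  · obtain ⟨w, hw⟩ := hθ (projKer α s hs m)
    obtain ⟨u, hu⟩ := hst (α m)
    obtain ⟨p, hp⟩ := h0 (projKer α s hs m)
    have hk : α (projKer α s hs m) = 0 := (projKer α s hs m).2
    replace hw : (θ (projKer α s hs m) : M) -
        (projKer α s hs m - t (β (projKer α s hs m))) = (X : R[X]) • (w : M) :=
      congrArg Subtype.val hw
    rw [hk, zero_sub] at hp
    rw [← neg_neg (β _), hp, map_neg, map_smul, coe_projKer α s hs m] at hw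
    refine ⟨w + t p + u, ?_⟩
    rw [hΓ, smul_add, smul_add, ← hw, ← hu]
    abel
  · have hβθ : β (θ (projKer α s hs m)) = 0 := (θ (projKer α s hs m)).2
    rw [hΓ, map_add, hβθ, ht, zero_add]
end

section
/- Let R be a commutative Noetherian ring of finite Krull dimension d ≥ 1 and let A be a geometric subring of R[T]. Let s, t ∈ R be such that sR + tR = R and A_s = R_s[T]. Let M and M' be finitely generated A-modules such that there exist isomorphisms σ₁ : M_s ≅ M'_s and σ₂ : M_t ≅ M'_t satisfying (1) (σ₁)_t ⊗ (A/I_A)_st = (σ₂)_s ⊗ (A/I_A)_st, and (2) M_st is a free A_st-module. Then there exists an isomorphism σ : M ≅ M' such that σ ⊗ (A/I_A)_s = σ₁ ⊗ (A/I_A)_s and σ ⊗ (A/I_A)_t = σ₂ ⊗ (A/I_A)_t. -/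
open Polynomial

set_option maxHeartbeats 1000000
set_option synthInstance.maxHeartbeats 400000

/-- `A` is a geometric subring of `R[T]`, where `d = dim R`. -/
def IsGeometricSubring {R : Type*} [CommRing R] (A : Subalgebra R (Polynomial R)) (d : ℕ) : Prop :=
  IsNoetherianRing A ∧
  (∃ s : R, s ∈ nonZeroDivisors R ∧ ∀ f : Polynomial R, ∃ k : ℕ, (C s) ^ k * f ∈ A) ∧
  ringKrullDim A = (d + 1 : ℕ)

/-- The ideal `I_A = { f ∈ A : f(0) = 0 }` of a subring `A` of `R[T]`. -/
noncomputable def idealIA {R : Type*} [CommRing R] (A : Subalgebra R (Polynomial R)) : Ideal A :=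
  RingHom.ker ((evalRingHom (0 : R)).comp A.val.toRingHom)

/-- The canonical map between localizations of a module at nested multiplicative sets. -/
noncomputable def locToLoc {A : Type*} [CommRing A] {S T : Submonoid A} (h : S ≤ T)
    (M : Type*) [AddCommGroup M] [Module A M] :
    LocalizedModule S M →ₗ[A] LocalizedModule T M :=
  IsLocalizedModule.lift S (LocalizedModule.mkLinearMap S M)
    (LocalizedModule.mkLinearMap T M)
    (fun s => IsLocalizedModule.map_units (LocalizedModule.mkLinearMap T M) ⟨s.1, h s.2⟩)

universe v

section maps

variable {R : Type*} [CommRing R] (A : Subalgebra R (Polynomial R)) (s t : R)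

theorem powers_sup_le_comap :
    Submonoid.powers s ⊔ Submonoid.powers t ≤
      Submonoid.comap (algebraMap R A)
        (Submonoid.powers (algebraMap R A s) ⊔ Submonoid.powers (algebraMap R A t)) := by
  apply sup_le
  · exact Submonoid.powers_le.mpr
      (Submonoid.mem_comap.mpr (SetLike.le_def.mp le_sup_left (Submonoid.mem_powers _)))
  · exact Submonoid.powers_le.mpr
      (Submonoid.mem_comap.mpr (SetLike.le_def.mp le_sup_right (Submonoid.mem_powers _)))

/-- The canonical map `R_st → A_st` induced by the inclusion `R ⊆ A` on the localizations at the
multiplicative set generated by `s` and `t`. -/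
noncomputable def rstToAst :
    Localization (Submonoid.powers s ⊔ Submonoid.powers t) →+*
      Localization (Submonoid.powers (algebraMap R A s) ⊔ Submonoid.powers (algebraMap R A t)) :=
  IsLocalization.map
    (Localization (Submonoid.powers (algebraMap R A s) ⊔ Submonoid.powers (algebraMap R A t)))
    (algebraMap R A) (powers_sup_le_comap A s t)

end maps

theorem LinearMap.map_mem_smul_top {A Q Q' : Type*} [CommRing A] [AddCommGroup Q] [Module A Q]
    [AddCommGroup Q'] [Module A Q'] (g : Q →ₗ[A] Q') {I : Ideal A} {y : Q}
    (hy : y ∈ I • (⊤ : Submodule A Q)) : g y ∈ I • (⊤ : Submodule A Q') := by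
  have := Submodule.mem_map_of_mem (f := g) hy
  rw [Submodule.map_smul''] at this
  exact Submodule.smul_mono le_rfl le_top this

section Glue

variable {A : Type*} [CommRing A] {s t : A} {T : Submonoid A}
  {M P₁ P₂ P : Type*} [AddCommGroup M] [Module A M]
  [AddCommGroup P₁] [Module A P₁] [AddCommGroup P₂] [Module A P₂] [AddCommGroup P] [Module A P]
  (f₁ : M →ₗ[A] P₁) [IsLocalizedModule (Submonoid.powers s) f₁]
  (f₂ : M →ₗ[A] P₂) [IsLocalizedModule (Submonoid.powers t) f₂]
  (f : M →ₗ[A] P) [IsLocalizedModule T f]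
  {ι₁ : P₁ →ₗ[A] P} {ι₂ : P₂ →ₗ[A] P}

include f₁ in
theorem pow_smul_injective_of_away (n : ℕ) {x y : P₁} (h : s ^ n • x = s ^ n • y) : x = y :=
  IsLocalizedModule.smul_injective f₁ (⟨s ^ n, n, rfl⟩ : Submonoid.powers s) h

theorem exists_pow_smul_eq_of_away (y : P₁) : ∃ (m : M) (n : ℕ), s ^ n • y = f₁ m := by
  obtain ⟨⟨m, ⟨_, n, rfl⟩⟩, h⟩ := IsLocalizedModule.surj (Submonoid.powers s) f₁ y
  exact ⟨m, n, h⟩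

theorem exists_pow_smul_eq_zero_of_away {m : M} (h : f₁ m = 0) : ∃ n : ℕ, s ^ n • m = 0 := by
  obtain ⟨⟨_, n, rfl⟩, h⟩ := (IsLocalizedModule.eq_zero_iff (Submonoid.powers s) f₁).1 h
  exact ⟨n, h⟩

theorem exists_pow_mul_pow_eq (hT : T ≤ Submonoid.powers s ⊔ Submonoid.powers t) (u : T) :
    ∃ a b : ℕ, (u : A) = s ^ a * t ^ b := by
  obtain ⟨_, ⟨a, rfl⟩, _, ⟨b, rfl⟩, h⟩ := Submonoid.mem_sup.1 (hT u.2)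
  exact ⟨a, b, h.symm⟩

theorem eq_zero_of_away (hst : IsCoprime s t) {m : M} (h₁ : f₁ m = 0) (h₂ : f₂ m = 0) :
    m = 0 := by
  obtain ⟨a, ha⟩ := exists_pow_smul_eq_zero_of_away (s := s) f₁ h₁
  obtain ⟨b, hb⟩ := exists_pow_smul_eq_zero_of_away (s := t) f₂ h₂
  obtain ⟨x, y, hxy⟩ := (hst.pow : IsCoprime (s ^ a) (t ^ b))
  rw [← one_smul A m, ← hxy, add_smul, mul_smul, mul_smul, ha, hb, smul_zero, smul_zero, add_zero]

theorem exists_eq_of_away (hst : IsCoprime s t)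
    (hT : T ≤ Submonoid.powers s ⊔ Submonoid.powers t)
    (hι₁ : ∀ m, ι₁ (f₁ m) = f m) (hι₂ : ∀ m, ι₂ (f₂ m) = f m)
    {y₁ : P₁} {y₂ : P₂} (h : ι₁ y₁ = ι₂ y₂) : ∃ m, f₁ m = y₁ ∧ f₂ m = y₂ := by
  obtain ⟨m₁, a, h₁⟩ := exists_pow_smul_eq_of_away (s := s) f₁ y₁
  obtain ⟨m₂, b, h₂⟩ := exists_pow_smul_eq_of_away (s := t) f₂ y₂
  have h0 : f (t ^ b • m₁ - s ^ a • m₂) = 0 := by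
    rw [map_sub, map_smul, map_smul, ← hι₁, ← hι₂, ← h₁, ← h₂, map_smul, map_smul, h,
      smul_comm, sub_self]
  obtain ⟨u, hu⟩ := (IsLocalizedModule.eq_zero_iff T f).1 h0
  obtain ⟨c, d, hcd⟩ := exists_pow_mul_pow_eq hT u
  rw [Submonoid.smul_def, hcd] at hu
  have key : t ^ (b + d) • s ^ c • m₁ = s ^ (a + c) • t ^ d • m₂ := by
    rw [← sub_eq_zero, ← hu, smul_sub]
    simp only [smul_smul]
    congr 2 <;> ring
  obtain ⟨x, y, hxy⟩ := (hst.pow : IsCoprime (s ^ (a + c)) (t ^ (b + d)))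
  refine ⟨x • s ^ c • m₁ + y • t ^ d • m₂, ?_, ?_⟩
  · apply pow_smul_injective_of_away (s := s) f₁ (a + c)
    rw [← map_smul, smul_add, smul_comm _ y, ← key, smul_comm _ x, ← mul_smul, ← mul_smul y,
      ← add_smul, hxy, one_smul, map_smul, ← h₁, smul_smul, pow_add, mul_comm]
  · apply pow_smul_injective_of_away (s := t) f₂ (b + d)
    rw [← map_smul, smul_add, smul_comm _ x, key, smul_comm _ y, ← mul_smul, ← mul_smul y,
      ← add_smul, hxy, one_smul, map_smul, ← h₂, smul_smul, pow_add, mul_comm]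

variable {M' P₁' P₂' P' : Type*} [AddCommGroup M'] [Module A M']
  [AddCommGroup P₁'] [Module A P₁'] [AddCommGroup P₂'] [Module A P₂']
  [AddCommGroup P'] [Module A P']
  (f₁' : M' →ₗ[A] P₁') [IsLocalizedModule (Submonoid.powers s) f₁']
  (f₂' : M' →ₗ[A] P₂') [IsLocalizedModule (Submonoid.powers t) f₂']
  (f' : M' →ₗ[A] P') [IsLocalizedModule T f']
  {ι₁' : P₁' →ₗ[A] P'} {ι₂' : P₂' →ₗ[A] P'}

theorem exists_linearMap_of_away (hst : IsCoprime s t)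
    (hT : T ≤ Submonoid.powers s ⊔ Submonoid.powers t)
    (hι₁' : ∀ m, ι₁' (f₁' m) = f' m) (hι₂' : ∀ m, ι₂' (f₂' m) = f' m)
    (g₁ : M →ₗ[A] P₁') (g₂ : M →ₗ[A] P₂') (h : ∀ m, ι₁' (g₁ m) = ι₂' (g₂ m)) :
    ∃ g : M →ₗ[A] M', (∀ m, f₁' (g m) = g₁ m) ∧ ∀ m, f₂' (g m) = g₂ m := by
  choose g hg using fun m => exists_eq_of_away f₁' f₂' f' hst hT hι₁' hι₂' (h m)
  refine ⟨{ toFun := g, map_add' := fun x y => ?_, map_smul' := fun r x => ?_ },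
    fun m => (hg m).1, fun m => (hg m).2⟩
  · rw [← sub_eq_zero]
    apply eq_zero_of_away f₁' f₂' hst <;> simp [hg]
  · rw [← sub_eq_zero]
    apply eq_zero_of_away f₁' f₂' hst <;> simp [hg]

theorem exists_linearEquiv_of_away (hst : IsCoprime s t)
    (hT : T ≤ Submonoid.powers s ⊔ Submonoid.powers t)
    (hι₁ : ∀ m, ι₁ (f₁ m) = f m) (hι₂ : ∀ m, ι₂ (f₂ m) = f m)
    (hι₁' : ∀ m, ι₁' (f₁' m) = f' m) (hι₂' : ∀ m, ι₂' (f₂' m) = f' m)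
    (g₁ : P₁ ≃ₗ[A] P₁') (g₂ : P₂ ≃ₗ[A] P₂')
    (h : ∀ m, ι₁' (g₁ (f₁ m)) = ι₂' (g₂ (f₂ m)))
    (h' : ∀ m, ι₁ (g₁.symm (f₁' m)) = ι₂ (g₂.symm (f₂' m))) :
    ∃ g : M ≃ₗ[A] M', (∀ m, f₁' (g m) = g₁ (f₁ m)) ∧ ∀ m, f₂' (g m) = g₂ (f₂ m) := by
  obtain ⟨g, hg₁, hg₂⟩ := exists_linearMap_of_away f₁' f₂' f' hst hT hι₁' hι₂'
    (g₁.toLinearMap ∘ₗ f₁) (g₂.toLinearMap ∘ₗ f₂) h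
  obtain ⟨k, hk₁, hk₂⟩ := exists_linearMap_of_away f₁ f₂ f hst hT hι₁ hι₂
    (g₁.symm.toLinearMap ∘ₗ f₁') (g₂.symm.toLinearMap ∘ₗ f₂') h'
  simp only [LinearMap.comp_apply, LinearEquiv.coe_coe] at hg₁ hg₂ hk₁ hk₂
  have hext : ∀ {m₁ m₂}, f₁ m₁ = f₁ m₂ → f₂ m₁ = f₂ m₂ → m₁ = m₂ := fun h₁ h₂ =>
    sub_eq_zero.1 (eq_zero_of_away f₁ f₂ hst (by rw [map_sub, h₁, sub_self])
      (by rw [map_sub, h₂, sub_self]))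
  have hext' : ∀ {m₁ m₂}, f₁' m₁ = f₁' m₂ → f₂' m₁ = f₂' m₂ → m₁ = m₂ := fun h₁ h₂ =>
    sub_eq_zero.1 (eq_zero_of_away f₁' f₂' hst (by rw [map_sub, h₁, sub_self])
      (by rw [map_sub, h₂, sub_self]))
  refine ⟨LinearEquiv.ofLinearMap g k ?_ ?_, hg₁, hg₂⟩
  · ext m
    apply hext' <;> simp [hg₁, hg₂, hk₁, hk₂]
  · ext m
    apply hext <;> simp [hg₁, hg₂, hk₁, hk₂]

end Glue

section Lift

variable {A : Type*} [CommRing A] [IsNoetherianRing A] {s t : A} {T : Submonoid A}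
  {M P₁ P : Type*} [AddCommGroup M] [Module A M] [Module.Finite A M]
  [AddCommGroup P₁] [Module A P₁] [AddCommGroup P] [Module A P]
  (f₁ : M →ₗ[A] P₁) [IsLocalizedModule (Submonoid.powers s) f₁]
  (f : M →ₗ[A] P) [IsLocalizedModule T f]
  {ι : P₁ →ₗ[A] P}

include f₁ f in
theorem exists_pow_smul_eq_zero_of_map_eq_zero
    (hT : T ≤ Submonoid.powers s ⊔ Submonoid.powers t)
    (hι : ∀ m, ι (f₁ m) = f m) : ∃ k : ℕ, ∀ y, ι y = 0 → t ^ k • y = 0 := by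
  obtain ⟨u, hu⟩ := Module.Finite.exists_smul_of_comp_eq_of_isLocalizedModule T f
    (LinearMap.ker f).subtype 0 (by ext x; simp)
  obtain ⟨a, k, hak⟩ := exists_pow_mul_pow_eq hT u
  refine ⟨k, fun y hy => ?_⟩
  obtain ⟨m, n, hm⟩ := exists_pow_smul_eq_of_away (s := s) f₁ y
  have hfm : f m = 0 := by rw [← hι, ← hm, map_smul, hy, smul_zero]
  have hum : (s ^ a * t ^ k) • m = 0 := by
    have := LinearMap.congr_fun hu ⟨m, hfm⟩
    rw [← hak]
    simpa [Submonoid.smul_def] using this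
  apply pow_smul_injective_of_away (s := s) f₁ (a + n)
  rw [smul_zero, pow_add, smul_comm, smul_smul, mul_comm, mul_assoc, mul_comm _ (t ^ k),
    ← mul_assoc, mul_smul, hm, ← map_smul, hum, map_zero]

theorem exists_end_lift (hs : s ∈ T)
    (hT : T ≤ Submonoid.powers s ⊔ Submonoid.powers t)
    (hι : ∀ m, ι (f₁ m) = f m) (g : P →ₗ[A] P) :
    ∃ (k : ℕ) (x : P₁ →ₗ[A] P₁), ∀ y, ι (x y) = t ^ k • g (ι y) := by
  have := Module.finitePresentation_of_finite A M
  obtain ⟨e, u, he⟩ := Module.FinitePresentation.exists_lift_of_isLocalizedModule T f (g ∘ₗ f)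
  obtain ⟨a, k, hak⟩ := exists_pow_mul_pow_eq hT u
  have hsT : ∀ (a : ℕ) {x y : P}, s ^ a • x = s ^ a • y → x = y := fun a x y h =>
    IsLocalizedModule.smul_injective f (⟨s ^ a, pow_mem hs a⟩ : T) h
  let e₁ := IsLocalizedModule.map (Submonoid.powers s) f₁ f₁ e
  obtain ⟨w, hw⟩ := IsLocalizedModule.map_units f₁ (⟨s ^ a, a, rfl⟩ : Submonoid.powers s)
  have hw' : ∀ y, s ^ a • (w⁻¹.1 y) = y := fun y => by
    have := LinearMap.congr_fun w.mul_inv y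
    rw [hw] at this
    simpa [-map_pow, Module.algebraMap_end_apply] using this
  refine ⟨k, w⁻¹.1 ∘ₗ e₁, fun y => ?_⟩
  obtain ⟨m, n, hm⟩ := exists_pow_smul_eq_of_away (s := s) f₁ y
  apply hsT a
  rw [← map_smul, LinearMap.comp_apply, hw']
  apply hsT n
  rw [← map_smul, ← map_smul, hm, smul_comm (s ^ n), smul_comm (s ^ n), ← map_smul g, ← map_smul ι,
    hm, hι, IsLocalizedModule.map_apply, hι, smul_smul, ← hak]
  exact LinearMap.congr_fun he m

variable {L : Type*} [CommRing L] [Algebra A L] [IsLocalization T L] [Module L P]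
  [IsScalarTower A L P]

/-- The endomorphisms of `P` which come from endomorphisms of `P₁` with image in `I P₁`. -/
def liftableEnd (L : Type*) [CommRing L] [Algebra A L] [Module L P] [IsScalarTower A L P]
    (ι : P₁ →ₗ[A] P) (I : Ideal A) : Submodule A (Module.End L P) where
  carrier := {g | ∃ x : P₁ →ₗ[A] P₁, (∀ y, x y ∈ I • (⊤ : Submodule A P₁)) ∧
    ∀ y, ι (x y) = g (ι y)}
  zero_mem' := ⟨0, fun y => zero_mem _, fun y => by simp⟩
  add_mem' := by
    rintro g h ⟨x, hx, hx'⟩ ⟨y, hy, hy'⟩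
    exact ⟨x + y, fun z => add_mem (hx z) (hy z), fun z => by simp [hx', hy']⟩
  smul_mem' := by
    rintro c g ⟨x, hx, hx'⟩
    exact ⟨c • x, fun z => Submodule.smul_mem _ c (hx z), fun z => by simp [hx']⟩

include f₁ f in
theorem exists_pow_smul_mem_liftableEnd (hs : s ∈ T)
    (hT : T ≤ Submonoid.powers s ⊔ Submonoid.powers t)
    (hι : ∀ m, ι (f₁ m) = f m) (I : Ideal A) {g : Module.End L P}
    (hg : g ∈ I.map (algebraMap A L) • (⊤ : Submodule L (Module.End L P))) :
    ∃ k : ℕ, t ^ k • g ∈ liftableEnd L ι I := by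
  refine Submodule.smul_induction_on hg (fun c hc g _ => ?_) fun g h hg hh => ?_
  · obtain ⟨⟨i, u⟩, hiu⟩ := (IsLocalization.mem_map_algebraMap_iff T L).1 hc
    let g' : Module.End L P := IsLocalization.mk' L 1 u • g
    have hg' : c • g = (i : A) • g' := by
      rw [← algebraMap_smul L (i : A) g', smul_smul]
      congr 1
      rw [IsLocalization.eq_mk'_iff_mul_eq.2 hiu, IsLocalization.mk'_eq_mul_mk'_one]
    obtain ⟨k, x, hx⟩ := exists_end_lift f₁ f hs hT hι (g'.restrictScalars A)
    refine ⟨k, (i : A) • x, fun y => Submodule.smul_mem_smul i.2 trivial, fun y => ?_⟩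
    rw [hg', LinearMap.smul_apply, map_smul, hx, smul_comm]
    rfl
  · obtain ⟨a, ha⟩ := hg
    obtain ⟨b, hb⟩ := hh
    refine ⟨a + b, ?_⟩
    rw [smul_add]
    refine add_mem ?_ ?_
    · rw [pow_add, mul_comm, mul_smul]
      exact Submodule.smul_mem _ _ ha
    · rw [pow_add, mul_smul]
      exact Submodule.smul_mem _ _ hb

include f₁ f in
theorem exists_forall_lift_linearEquiv (hs : s ∈ T) (ht : t ∈ T)
    (hT : T ≤ Submonoid.powers s ⊔ Submonoid.powers t)
    (hι : ∀ m, ι (f₁ m) = f m) (I : Ideal A) (n : ℕ) (g g' : ℕ → Module.End L P)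
    (hg : ∀ i, g i ∈ I.map (algebraMap A L) • (⊤ : Submodule L (Module.End L P)))
    (hg' : ∀ i, g' i ∈ I.map (algebraMap A L) • (⊤ : Submodule L (Module.End L P))) :
    ∃ K : ℕ, ∀ c : ℕ → A, (∀ i, t ^ K ∣ c i) →
      (1 + ∑ i ∈ Finset.range n, c i • g i) * (1 + ∑ i ∈ Finset.range n, c i • g' i) = 1 →
      (1 + ∑ i ∈ Finset.range n, c i • g' i) * (1 + ∑ i ∈ Finset.range n, c i • g i) = 1 →
      ∃ θ : P₁ ≃ₗ[A] P₁, (∀ y, θ y - y ∈ I • (⊤ : Submodule A P₁)) ∧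
        (∀ y, ι (θ y) = (1 + ∑ i ∈ Finset.range n, c i • g i) (ι y)) ∧
        (∀ y, ι (θ.symm y) = (1 + ∑ i ∈ Finset.range n, c i • g' i) (ι y)) := by
  obtain ⟨k, hk⟩ := exists_pow_smul_eq_zero_of_map_eq_zero f₁ f hT hι
  have key : ∀ g : ℕ → Module.End L P,
      (∀ i, g i ∈ I.map (algebraMap A L) • (⊤ : Submodule L (Module.End L P))) →
      ∃ K : ℕ, ∀ c : ℕ → A, (∀ i, t ^ K ∣ c i) → ∃ x : P₁ →ₗ[A] P₁,
        (∀ y, x y ∈ I • (⊤ : Submodule A P₁)) ∧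
        ∀ y, ι (t ^ k • x y) = (∑ i ∈ Finset.range n, c i • g i) (ι y) := by
    intro g hg
    choose K hK using fun i => exists_pow_smul_mem_liftableEnd f₁ f hs hT hι I (hg i)
    refine ⟨k + ∑ i ∈ Finset.range n, K i, fun c hc => ?_⟩
    choose d hd using hc
    have hmem : ∑ i ∈ Finset.range n, (d i * t ^ ∑ i ∈ Finset.range n, K i) • g i ∈
        liftableEnd L ι I := by
      refine sum_mem fun i hi => ?_
      rw [← Finset.sum_erase_add _ _ hi, pow_add, ← mul_assoc, mul_smul]
      exact Submodule.smul_mem _ _ (hK i)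
    obtain ⟨x, hx, hx'⟩ := hmem
    refine ⟨x, hx, fun y => ?_⟩
    rw [map_smul, hx', ← LinearMap.smul_apply, Finset.smul_sum]
    congr 2 with i
    rw [hd, smul_smul, pow_add]
    congr 2
    ring
  obtain ⟨K, hK⟩ := key g hg
  obtain ⟨K', hK'⟩ := key g' hg'
  refine ⟨K + K', fun c hc h h' => ?_⟩
  obtain ⟨x, hx, hx'⟩ := hK c fun i => (pow_dvd_pow t (Nat.le_add_right K K')).trans (hc i)
  obtain ⟨x', hy, hy'⟩ := hK' c fun i => (pow_dvd_pow t (Nat.le_add_left K' K)).trans (hc i)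
  have inv : ∀ (x x' : P₁ →ₗ[A] P₁) (p p' : Module.End L P),
      (∀ y, ι (t ^ k • x y) = p (ι y)) → (∀ y, ι (t ^ k • x' y) = p' (ι y)) →
      (1 + p) * (1 + p') = 1 →
      (LinearMap.id + t ^ k • x) ∘ₗ (LinearMap.id + t ^ k • x') = LinearMap.id := by
    intro x x' p p' hp hp' hpp
    ext y
    have h0 : t ^ k • (x y + x' y + t ^ k • x (x' y)) = 0 := by
      have := LinearMap.congr_fun hpp (ι y)
      simp only [Module.End.mul_apply, LinearMap.add_apply, Module.End.one_apply] at this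
      rw [← hp', ← map_add, ← hp, ← map_add] at this
      have h1 : ι (t ^ k • (x y + x' y + t ^ k • x (x' y))) = 0 := by
        rw [← sub_eq_zero, ← map_sub] at this
        rw [← this]
        congr 1
        simp only [map_add, map_smul, smul_add]
        abel
      rw [map_smul] at h1
      refine hk _ (IsLocalizedModule.smul_injective f (⟨t ^ k, pow_mem ht k⟩ : T) ?_)
      simpa [Submonoid.smul_def] using h1
    simp only [LinearMap.comp_apply, LinearMap.add_apply, LinearMap.id_apply, LinearMap.smul_apply,
      map_add, map_smul, smul_add] at h0 ⊢
    rw [← sub_eq_zero, ← h0]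
    abel
  refine ⟨LinearEquiv.ofLinearMap (LinearMap.id + t ^ k • x) (LinearMap.id + t ^ k • x')
    (inv _ _ _ _ hx' hy' h) (inv _ _ _ _ hy' hx' h'), fun y => ?_, fun y => ?_, fun y => ?_⟩
  · simpa using Submodule.smul_mem _ _ (hx y)
  · change ι ((LinearMap.id + t ^ k • _ : P₁ →ₗ[A] P₁) y) = _
    simp only [LinearMap.add_apply, LinearMap.id_apply,
      LinearMap.smul_apply, map_add, hx', Module.End.one_apply]
  · change ι ((LinearMap.id + t ^ k • _ : P₁ →ₗ[A] P₁) y) = _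
    simp only [LinearMap.add_apply, LinearMap.id_apply,
      LinearMap.smul_apply, map_add, hy', Module.End.one_apply]

end Lift

section Splitting

variable {A : Type*} [CommRing A] [IsNoetherianRing A] {s t : A} {T : Submonoid A}
  {L : Type*} [CommRing L] [Algebra A L] [IsLocalization T L]
  {M P₁ P₂ P : Type*} [AddCommGroup M] [Module A M] [Module.Finite A M]
  [AddCommGroup P₁] [Module A P₁] [AddCommGroup P₂] [Module A P₂]
  [AddCommGroup P] [Module A P] [Module L P] [IsScalarTower A L P]
  (f₁ : M →ₗ[A] P₁) [IsLocalizedModule (Submonoid.powers s) f₁]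
  (f₂ : M →ₗ[A] P₂) [IsLocalizedModule (Submonoid.powers t) f₂]
  (f : M →ₗ[A] P) [IsLocalizedModule T f]
  {ι₁ : P₁ →ₗ[A] P} {ι₂ : P₂ →ₗ[A] P}

include f₁ f₂ f in
/-- Quillen's splitting: an automorphism of `P` which is the value at `1` of a polynomial family of
automorphisms starting at the identity factors into automorphisms coming from `P₁` and `P₂`. -/
theorem exists_splitting (hst : IsCoprime s t) (hs : s ∈ T) (ht : t ∈ T)
    (hT : T ≤ Submonoid.powers s ⊔ Submonoid.powers t)
    (hι₁ : ∀ m, ι₁ (f₁ m) = f m) (hι₂ : ∀ m, ι₂ (f₂ m) = f m)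
    (I : Ideal A) (n : ℕ) (a b : ℕ → Module.End L P)
    (ha : ∀ i, a i ∈ I.map (algebraMap A L) • (⊤ : Submodule L (Module.End L P)))
    (hb : ∀ i, b i ∈ I.map (algebraMap A L) • (⊤ : Submodule L (Module.End L P)))
    (hab : ∀ r : A, (1 + ∑ i ∈ Finset.range n, r ^ (i + 1) • a i) *
      (1 + ∑ i ∈ Finset.range n, r ^ (i + 1) • b i) = 1)
    (hba : ∀ r : A, (1 + ∑ i ∈ Finset.range n, r ^ (i + 1) • b i) *
      (1 + ∑ i ∈ Finset.range n, r ^ (i + 1) • a i) = 1) :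
    ∃ (θ₁ : P₁ ≃ₗ[A] P₁) (θ₂ : P₂ ≃ₗ[A] P₂) (p q : Module.End L P),
      (∀ y, θ₁ y - y ∈ I • (⊤ : Submodule A P₁)) ∧
      (∀ y, θ₂ y - y ∈ I • (⊤ : Submodule A P₂)) ∧
      (∀ y, ι₁ (θ₁ y) = (1 + ∑ i ∈ Finset.range n, b i) (p (ι₁ y))) ∧
      (∀ y, ι₂ (θ₂ y) = p (ι₂ y)) ∧
      (∀ y, ι₁ (θ₁.symm y) = q ((1 + ∑ i ∈ Finset.range n, a i) (ι₁ y))) ∧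
      (∀ y, ι₂ (θ₂.symm y) = q (ι₂ y)) := by
  set α : Module.End L P := 1 + ∑ i ∈ Finset.range n, a i with hα
  set β : Module.End L P := 1 + ∑ i ∈ Finset.range n, b i with hβ
  have hαβ : α * β = 1 := by simpa using hab 1
  have hβα : β * α = 1 := by simpa using hba 1
  have hga : ∀ i, β * a i ∈ I.map (algebraMap A L) • (⊤ : Submodule L (Module.End L P)) :=
    fun i => (LinearMap.mulLeft L β).map_mem_smul_top (ha i)
  have hgb : ∀ i, b i * α ∈ I.map (algebraMap A L) • (⊤ : Submodule L (Module.End L P)) :=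
    fun i => (LinearMap.mulRight L α).map_mem_smul_top (hb i)
  obtain ⟨K₁, h₁⟩ := exists_forall_lift_linearEquiv f₁ f hs ht hT hι₁ I n _ _ hga hgb
  obtain ⟨K₂, h₂⟩ := exists_forall_lift_linearEquiv f₂ f ht hs (by rwa [sup_comm]) hι₂ I n _ _
    ha hb
  obtain ⟨x, y, hxy⟩ := (hst.pow : IsCoprime (s ^ K₂) (t ^ K₁))
  set r := x * s ^ K₂ with hr
  set p : Module.End L P := 1 + ∑ i ∈ Finset.range n, r ^ (i + 1) • a i with hp
  set q : Module.End L P := 1 + ∑ i ∈ Finset.range n, r ^ (i + 1) • b i with hq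
  have hpq : p * q = 1 := hab r
  have hqp : q * p = 1 := hba r
  have hβp : 1 + ∑ i ∈ Finset.range n, (r ^ (i + 1) - 1) • (β * a i) = β * p := by
    rw [← hβα, hp, hα]
    simp only [mul_add, sub_smul, one_smul, Finset.sum_sub_distrib, Finset.mul_sum,
      mul_smul_comm]
    abel
  have hqα : 1 + ∑ i ∈ Finset.range n, (r ^ (i + 1) - 1) • (b i * α) = q * α := by
    rw [← hβα, hq, hβ]
    simp only [add_mul, sub_smul, one_smul, Finset.sum_sub_distrib, Finset.sum_mul,
      smul_mul_assoc]
    abel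
  obtain ⟨θ₁, hθ₁, hθ₁', hθ₁''⟩ := h₁ (fun i => r ^ (i + 1) - 1) (fun i => by
      refine dvd_trans ⟨-y, ?_⟩ (by simpa using sub_dvd_pow_sub_pow r 1 (i + 1))
      rw [← hxy]; ring)
    (by rw [hβp, hqα, mul_assoc, ← mul_assoc p, hpq, one_mul, hβα])
    (by rw [hβp, hqα, mul_assoc, ← mul_assoc α, hαβ, one_mul, hqp])
  obtain ⟨θ₂, hθ₂, hθ₂', hθ₂''⟩ := h₂ (fun i => r ^ (i + 1))
    (fun i => (Dvd.intro_left x rfl).trans (dvd_pow_self r i.succ_ne_zero)) hpq hqp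
  refine ⟨θ₁, θ₂, p, q, hθ₁, hθ₂, fun y => ?_, hθ₂', fun y => ?_, hθ₂''⟩
  · rw [hθ₁', hβp]; rfl
  · rw [hθ₁'', hqα]; rfl

variable {M' P₁' P₂' P' : Type*} [AddCommGroup M'] [Module A M']
  [AddCommGroup P₁'] [Module A P₁'] [AddCommGroup P₂'] [Module A P₂']
  [AddCommGroup P'] [Module A P'] [Module L P']
  (f₁' : M' →ₗ[A] P₁') [IsLocalizedModule (Submonoid.powers s) f₁']
  (f₂' : M' →ₗ[A] P₂') [IsLocalizedModule (Submonoid.powers t) f₂']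
  (f' : M' →ₗ[A] P') [IsLocalizedModule T f']
  {ι₁' : P₁' →ₗ[A] P'} {ι₂' : P₂' →ₗ[A] P'}

theorem exists_linearEquiv_of_polynomial_family
    (hst : IsCoprime s t) (hs : s ∈ T) (ht : t ∈ T)
    (hT : T ≤ Submonoid.powers s ⊔ Submonoid.powers t)
    (hι₁ : ∀ m, ι₁ (f₁ m) = f m) (hι₂ : ∀ m, ι₂ (f₂ m) = f m)
    (hι₁' : ∀ m, ι₁' (f₁' m) = f' m) (hι₂' : ∀ m, ι₂' (f₂' m) = f' m)
    (σ₁ : P₁ ≃ₗ[A] P₁') (σ₂ : P₂ ≃ₗ[A] P₂') (e₁ e₂ : P ≃ₗ[L] P')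
    (he₁ : ∀ y, e₁ (ι₁ y) = ι₁' (σ₁ y)) (he₂ : ∀ y, e₂ (ι₂ y) = ι₂' (σ₂ y))
    (I : Ideal A) (n : ℕ) (a b : ℕ → Module.End L P)
    (ha : ∀ i, a i ∈ I.map (algebraMap A L) • (⊤ : Submodule L (Module.End L P)))
    (hb : ∀ i, b i ∈ I.map (algebraMap A L) • (⊤ : Submodule L (Module.End L P)))
    (hab : ∀ r : A, (1 + ∑ i ∈ Finset.range n, r ^ (i + 1) • a i) *
      (1 + ∑ i ∈ Finset.range n, r ^ (i + 1) • b i) = 1)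
    (hba : ∀ r : A, (1 + ∑ i ∈ Finset.range n, r ^ (i + 1) • b i) *
      (1 + ∑ i ∈ Finset.range n, r ^ (i + 1) • a i) = 1)
    (hα : ∀ y, (1 + ∑ i ∈ Finset.range n, a i) y = e₂.symm (e₁ y)) :
    ∃ σ : M ≃ₗ[A] M', (∀ m, f₁' (σ m) - σ₁ (f₁ m) ∈ I • (⊤ : Submodule A P₁')) ∧
      ∀ m, f₂' (σ m) - σ₂ (f₂ m) ∈ I • (⊤ : Submodule A P₂') := by
  obtain ⟨θ₁, θ₂, p, q, hθ₁, hθ₂, h₁, h₂, h₁', h₂'⟩ :=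
    exists_splitting f₁ f₂ f hst hs ht hT hι₁ hι₂ I n a b ha hb hab hba
  have hβ : ∀ y, e₁ ((1 + ∑ i ∈ Finset.range n, b i) y) = e₂ y := fun y => by
    have hαβ : (1 + ∑ i ∈ Finset.range n, a i) * (1 + ∑ i ∈ Finset.range n, b i) = 1 := by
      simpa using hab 1
    have := LinearMap.congr_fun hαβ y
    rw [Module.End.mul_apply, hα] at this
    exact e₂.symm_apply_eq.1 this
  have he₁' : ∀ y, ι₁ (σ₁.symm y) = e₁.symm (ι₁' y) := fun y => by
    rw [LinearEquiv.eq_symm_apply, he₁, LinearEquiv.apply_symm_apply]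
  have he₂' : ∀ y, ι₂ (σ₂.symm y) = e₂.symm (ι₂' y) := fun y => by
    rw [LinearEquiv.eq_symm_apply, he₂, LinearEquiv.apply_symm_apply]
  obtain ⟨σ, hσ₁, hσ₂⟩ := exists_linearEquiv_of_away f₁ f₂ f f₁' f₂' f' hst hT hι₁ hι₂ hι₁' hι₂'
    (θ₁.trans σ₁) (θ₂.trans σ₂)
    (fun m => by
      rw [LinearEquiv.trans_apply, LinearEquiv.trans_apply, ← he₁, ← he₂, h₁, h₂, hβ, hι₁, hι₂])
    (fun m => by
      rw [LinearEquiv.symm_trans_apply, LinearEquiv.symm_trans_apply, h₁', h₂', he₁', he₂', hα,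
        LinearEquiv.apply_symm_apply, hι₁', hι₂'])
  refine ⟨σ, fun m => ?_, fun m => ?_⟩
  · rw [hσ₁, LinearEquiv.trans_apply, ← map_sub]
    exact σ₁.toLinearMap.map_mem_smul_top (hθ₁ _)
  · rw [hσ₂, LinearEquiv.trans_apply, ← map_sub]
    exact σ₂.toLinearMap.map_mem_smul_top (hθ₂ _)

end Splitting

section Family

variable {L : Type*} [CommRing L] {P : Type*} [AddCommGroup P] [Module L P]

theorem toLin_mem_smul_top {ι : Type*} [Fintype ι] [DecidableEq ι] (v : Module.Basis ι L P)
    (J : Ideal L) (X : Matrix ι ι L) (hX : ∀ i j, X i j ∈ J) :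
    Matrix.toLin v v X ∈ J • (⊤ : Submodule L (Module.End L P)) := by
  rw [Matrix.matrix_eq_sum_single X, map_sum]
  refine sum_mem fun i _ => ?_
  rw [map_sum]
  refine sum_mem fun j _ => ?_
  rw [← mul_one (X i j), ← smul_eq_mul, ← Matrix.smul_single, map_smul]
  exact Submodule.smul_mem_smul (hX i j) trivial

/-- An automorphism congruent to the identity modulo `J` is joined to the identity by a polynomial
family of automorphisms, provided that `L` carries a ring homomorphism `h : L →+* L[X]` playing the
role of `f(T) ↦ f(XT)`. -/
theorem exists_polynomial_family [Module.Free L P] [Module.Finite L P] (J : Ideal L)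
    (h : L →+* L[X]) (h1 : ∀ c, (h c).eval 1 = c) (h0 : ∀ c ∈ J, (h c).coeff 0 = 0)
    (hJ : ∀ c i, (h c).coeff (i + 1) ∈ J) (e : P ≃ₗ[L] P)
    (he : ∀ y, e y - y ∈ J • (⊤ : Submodule L P)) :
    ∃ (n : ℕ) (a b : ℕ → Module.End L P),
      (∀ i, a i ∈ J • (⊤ : Submodule L (Module.End L P))) ∧
      (∀ i, b i ∈ J • (⊤ : Submodule L (Module.End L P))) ∧
      (∀ r : L, (1 + ∑ i ∈ Finset.range n, r ^ (i + 1) • a i) *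
        (1 + ∑ i ∈ Finset.range n, r ^ (i + 1) • b i) = 1) ∧
      (∀ r : L, (1 + ∑ i ∈ Finset.range n, r ^ (i + 1) • b i) *
        (1 + ∑ i ∈ Finset.range n, r ^ (i + 1) • a i) = 1) ∧
      ∀ y, (1 + ∑ i ∈ Finset.range n, a i) y = e y := by
  classical
  let v := Module.Free.chooseBasis L P
  let H : L → L →+* L := fun r => (evalRingHom r).comp h
  let coef : ℕ → Module.End L P → Module.End L P := fun i g =>
    Matrix.toLin v v ((LinearMap.toMatrix v v g).map fun c => (h c).coeff (i + 1))
  have hcoef : ∀ i g, coef i g ∈ J • (⊤ : Submodule L (Module.End L P)) := fun i g =>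
    toLin_mem_smul_top v J _ fun _ _ => hJ _ _
  have key : ∀ g : Module.End L P, (∀ y, g y - y ∈ J • (⊤ : Submodule L P)) →
      ∃ n, ∀ N ≥ n, ∀ r : L, (1 + ∑ i ∈ Finset.range N, r ^ (i + 1) • coef i g) =
        Matrix.toLin v v ((H r).mapMatrix (LinearMap.toMatrix v v g)) := by
    intro g hg
    let X := LinearMap.toMatrix v v g
    refine ⟨∑ i, ∑ j, (h (X i j)).natDegree, fun N hN r => ?_⟩
    have hX : (H r).mapMatrix X = 1 + ∑ k ∈ Finset.range N, r ^ (k + 1) •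
        X.map fun c => (h c).coeff (k + 1) := by
      ext i j
      have hdeg : (h (X i j)).natDegree < N + 1 := by
        refine Nat.lt_succ_of_le (le_trans ?_ hN)
        refine le_trans ?_ (Finset.single_le_sum (f := fun i => ∑ j, (h (X i j)).natDegree)
          (fun _ _ => Nat.zero_le _) (Finset.mem_univ i))
        exact Finset.single_le_sum (f := fun j => (h (X i j)).natDegree)
          (fun _ _ => Nat.zero_le _) (Finset.mem_univ j)
      have hij : (h (X i j)).coeff 0 = (1 : Matrix _ _ L) i j := by
        have hmem : X i j - (1 : Matrix _ _ L) i j ∈ J := by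
          have := (v.coord i).map_mem_smul_top (hg (v j))
          simpa [X, LinearMap.toMatrix_apply, Matrix.one_apply, Finsupp.single_apply,
            eq_comm] using this
        have := h0 _ hmem
        rw [map_sub, coeff_sub, sub_eq_zero] at this
        rw [this, Matrix.one_apply]
        split_ifs <;> simp
      rw [RingHom.mapMatrix_apply, Matrix.map_apply, RingHom.comp_apply, coe_evalRingHom,
        eval_eq_sum_range' hdeg, Finset.sum_range_succ', hij]
      simp [Matrix.sum_apply, mul_comm, add_comm]
    rw [hX, map_add, map_sum, Matrix.toLin_one]
    simp [coef, X, Module.End.one_eq_id]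
  have he' : ∀ y, e.symm y - y ∈ J • (⊤ : Submodule L P) := fun y => by
    simpa using neg_mem (e.symm.toLinearMap.map_mem_smul_top (he y))
  obtain ⟨n, hn⟩ := key e.toLinearMap he
  obtain ⟨n', hn'⟩ := key e.symm.toLinearMap he'
  have hmul : ∀ (g g' : Module.End L P) (r : L), g * g' = 1 →
      Matrix.toLin v v ((H r).mapMatrix (LinearMap.toMatrix v v g)) *
        Matrix.toLin v v ((H r).mapMatrix (LinearMap.toMatrix v v g')) = 1 := by
    intro g g' r hg
    rw [Module.End.mul_eq_comp, ← Matrix.toLin_mul, ← map_mul, ← LinearMap.toMatrix_mul, hg,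
      LinearMap.toMatrix_one, map_one, Matrix.toLin_one, Module.End.one_eq_id]
  have hee : e.toLinearMap * e.symm.toLinearMap = 1 := by ext; simp
  have hee' : e.symm.toLinearMap * e.toLinearMap = 1 := by ext; simp
  refine ⟨n + n', fun i => coef i e.toLinearMap, fun i => coef i e.symm.toLinearMap,
    fun i => hcoef _ _, fun i => hcoef _ _, fun r => ?_, fun r => ?_, fun y => ?_⟩
  · rw [hn _ (Nat.le_add_right _ _), hn' _ (Nat.le_add_left _ _)]
    exact hmul _ _ _ hee
  · rw [hn _ (Nat.le_add_right _ _), hn' _ (Nat.le_add_left _ _)]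
    exact hmul _ _ _ hee'
  · have := hn (n + n') (Nat.le_add_right _ _) 1
    simp only [one_pow, one_smul] at this
    rw [this]
    have hid : H 1 = RingHom.id L := RingHom.ext h1
    rw [hid]
    simp

end Family

section Geometric

variable {R : Type*} [CommRing R] (A : Subalgebra R R[X]) {s : R}
  {T : Submonoid A} (L : Type*) [CommRing L] [Algebra A L] [IsLocalization T L]

include T in
/-- If `A_s = R_s[X]` and `s` is invertible in `L`, then `A → L` extends to `R[X]`. -/
theorem exists_extend_algebraMap (hAs : ∀ f : R[X], ∃ k : ℕ, (C s) ^ k * f ∈ A)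
    (hs : algebraMap R A s ∈ T) :
    ∃ φ : R[X] →+* L, ∀ f : A, φ f = algebraMap A L f := by
  let K := Localization.Away (C s : R[X])
  have hval : ∀ n : ℕ, ((algebraMap R A s ^ n : A) : R[X]) = C s ^ n := fun n => by simp
  have hK : IsLocalization.Away (algebraMap R A s) K := by
    have halg : ∀ f : A, algebraMap A K f = algebraMap R[X] K f := fun f => rfl
    refine ⟨?_, ?_, ?_⟩
    · rintro ⟨_, n, rfl⟩
      change IsUnit (algebraMap A K (algebraMap R A s ^ n))
      rw [halg, hval]
      exact IsLocalization.map_units K (⟨_, n, rfl⟩ : Submonoid.powers (C s : R[X]))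
    · intro z
      obtain ⟨⟨f, ⟨_, n, rfl⟩⟩, hf⟩ := IsLocalization.surj (Submonoid.powers (C s : R[X])) z
      obtain ⟨k, hk⟩ := hAs f
      refine ⟨⟨⟨_, hk⟩, ⟨algebraMap R A s ^ (k + n), _, rfl⟩⟩, ?_⟩
      simp only [halg, hval] at hf ⊢
      rw [map_mul, ← hf, pow_add, map_mul]
      ring
    · intro x y hxy
      rw [halg, halg] at hxy
      obtain ⟨⟨_, n, rfl⟩, hn⟩ :=
        IsLocalization.exists_of_eq (M := Submonoid.powers (C s : R[X])) hxy
      refine ⟨⟨algebraMap R A s ^ n, n, rfl⟩, Subtype.ext ?_⟩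
      simpa using hn
  have hu : IsUnit (algebraMap A L (algebraMap R A s)) :=
    IsLocalization.map_units L (⟨_, hs⟩ : T)
  refine ⟨(IsLocalization.Away.lift (S := K) (algebraMap R A s) hu).comp (algebraMap R[X] K),
    fun f => ?_⟩
  exact IsLocalization.Away.lift_eq (S := K) (algebraMap R A s) hu f

theorem exists_scaling_hom (hAs : ∀ f : R[X], ∃ k : ℕ, (C s) ^ k * f ∈ A)
    (hs : algebraMap R A s ∈ T) (hT : ∀ u ∈ T, ∃ r : R, algebraMap R A r = u) :
    ∃ h : L →+* L[X], (∀ c, (h c).eval 1 = c) ∧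
      (∀ c ∈ (idealIA A).map (algebraMap A L), (h c).coeff 0 = 0) ∧
      ∀ c i, (h c).coeff (i + 1) ∈ (idealIA A).map (algebraMap A L) := by
  obtain ⟨φ, hφ⟩ := exists_extend_algebraMap A (T := T) L hAs hs
  let ψ₀ : R[X] →+* L[X] := (compRingHom (C (φ X) * X)).comp (mapRingHom (φ.comp C))
  let ψ : A →+* L[X] := ψ₀.comp A.val.toRingHom
  have hψC : ∀ r : R, ψ (algebraMap R A r) = C (algebraMap A L (algebraMap R A r)) := by
    intro r
    have : φ (C r) = algebraMap A L (algebraMap R A r) := hφ (algebraMap R A r)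
    simp [ψ, ψ₀, ← this, Polynomial.algebraMap_eq]
  have hcoeff : ∀ (f : A) (i : ℕ), (ψ f).coeff i = φ (C ((f : R[X]).coeff i)) * φ X ^ i := by
    intro f i
    simp [ψ, ψ₀, comp_C_mul_X_coeff]
  have hX : φ X ∈ (idealIA A).map (algebraMap A L) := by
    obtain ⟨k, hk⟩ := hAs X
    have hmem : (⟨_, hk⟩ : A) ∈ idealIA A := by simp [idealIA, RingHom.mem_ker]
    have := Ideal.mem_map_of_mem (algebraMap A L) hmem
    have hu : IsUnit (algebraMap A L (algebraMap R A s ^ k)) :=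
      IsLocalization.map_units L (⟨_, pow_mem hs k⟩ : T)
    rw [← Ideal.unit_mul_mem_iff_mem _ hu, ← hφ]
    rw [← hφ] at this
    simpa using this
  have hunit : ∀ u : T, IsUnit (ψ u) := by
    rintro ⟨u, hu⟩
    obtain ⟨r, rfl⟩ := hT u hu
    rw [hψC]
    exact (IsLocalization.map_units L (⟨_, hu⟩ : T)).map C
  refine ⟨IsLocalization.lift hunit, ?_, ?_, ?_⟩
  · have : (evalRingHom 1).comp (IsLocalization.lift hunit) = RingHom.id L := by
      refine IsLocalization.ringHom_ext T (RingHom.ext fun f => ?_)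
      have hψ : (evalRingHom 1).comp ψ₀ = φ := by
        refine Polynomial.ringHom_ext (fun r => ?_) ?_ <;> simp [ψ₀]
      simpa [hφ, ψ] using RingHom.congr_fun hψ f
    exact fun c => RingHom.congr_fun this c
  · have : (idealIA A).map (algebraMap A L) ≤
        RingHom.ker ((constantCoeff).comp (IsLocalization.lift hunit)) := by
      refine Ideal.map_le_iff_le_comap.2 fun f hf => ?_
      have hf0 : (f : R[X]).coeff 0 = 0 := by
        simpa [idealIA, RingHom.mem_ker, coeff_zero_eq_eval_zero] using hf
      simp [RingHom.mem_ker, hcoeff, hf0]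
    exact fun c hc => this hc
  · intro c i
    obtain ⟨⟨f, u, hu⟩, hf⟩ := IsLocalization.surj T c
    obtain ⟨r, rfl⟩ := hT u hu
    have hcu := congrArg (fun p => (IsLocalization.lift (S := L) hunit p).coeff (i + 1)) hf
    simp only [map_mul, IsLocalization.lift_eq, hψC, coeff_mul_C, hcoeff] at hcu
    rw [← Ideal.mul_unit_mem_iff_mem _ (IsLocalization.map_units L (⟨_, hu⟩ : T)), hcu, pow_succ,
      ← mul_assoc]
    exact Ideal.mul_mem_left _ _ hX

end Geometric

section LocToLoc

variable {A : Type*} [CommRing A] {S T : Submonoid A} (h : S ≤ T)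
  {M M' : Type*} [AddCommGroup M] [Module A M] [AddCommGroup M'] [Module A M']

theorem locToLoc_mkLinearMap (m : M) :
    locToLoc h M (LocalizedModule.mkLinearMap S M m) = LocalizedModule.mkLinearMap T M m :=
  IsLocalizedModule.lift_apply S _ _ _ m

theorem exists_locToLoc_linearMap (τ : LocalizedModule S M →ₗ[A] LocalizedModule S M') :
    ∃ g : LocalizedModule T M →ₗ[A] LocalizedModule T M',
      ∀ y, g (locToLoc h M y) = locToLoc h M' (τ y) := by
  let g := IsLocalizedModule.lift T (LocalizedModule.mkLinearMap T M)
    (locToLoc h M' ∘ₗ τ ∘ₗ LocalizedModule.mkLinearMap S M)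
    (IsLocalizedModule.map_units (LocalizedModule.mkLinearMap T M'))
  have : g ∘ₗ locToLoc h M = locToLoc h M' ∘ₗ τ := by
    refine IsLocalizedModule.ext S (LocalizedModule.mkLinearMap S M)
      (fun u => IsLocalizedModule.map_units (LocalizedModule.mkLinearMap T M') ⟨u.1, h u.2⟩) ?_
    ext m
    simp only [g, LinearMap.comp_apply, locToLoc_mkLinearMap, IsLocalizedModule.lift_apply]
  exact ⟨g, LinearMap.congr_fun this⟩

theorem exists_locToLoc_linearEquiv
    (σ : LocalizedModule S M ≃ₗ[A] LocalizedModule S M') :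
    ∃ e : LocalizedModule T M ≃ₗ[Localization T] LocalizedModule T M',
      ∀ y, e (locToLoc h M y) = locToLoc h M' (σ y) := by
  obtain ⟨g, hg⟩ := exists_locToLoc_linearMap h σ.toLinearMap
  obtain ⟨k, hk⟩ := exists_locToLoc_linearMap h σ.symm.toLinearMap
  have hgk : g ∘ₗ k = LinearMap.id :=
    IsLocalizedModule.ext T (LocalizedModule.mkLinearMap T M')
      (IsLocalizedModule.map_units (LocalizedModule.mkLinearMap T M')) <| LinearMap.ext fun m => by
        simp [← locToLoc_mkLinearMap h, hg, hk]
  have hkg : k ∘ₗ g = LinearMap.id :=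
    IsLocalizedModule.ext T (LocalizedModule.mkLinearMap T M)
      (IsLocalizedModule.map_units (LocalizedModule.mkLinearMap T M)) <| LinearMap.ext fun m => by
        simp [← locToLoc_mkLinearMap h, hg, hk]
  exact ⟨(LinearEquiv.ofLinearMap g k hgk hkg).extendScalarsOfIsLocalization T (Localization T),
    hg⟩

theorem mem_map_smul_top_of_mem (L : Type*) [CommRing L] [Algebra A L] [Module L M]
    [IsScalarTower A L M] {I : Ideal A} {y : M} (hy : y ∈ I • (⊤ : Submodule A M)) :
    y ∈ I.map (algebraMap A L) • (⊤ : Submodule L M) := by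
  refine Submodule.smul_induction_on hy (fun c hc z _ => ?_) fun x y hx hy => add_mem hx hy
  rw [← algebraMap_smul L c z]
  exact Submodule.smul_mem_smul (Ideal.mem_map_of_mem _ hc) trivial

/-- A linear map on `LocalizedModule T M` takes values in a submodule as soon as it does so on
the image of `M`. -/
theorem forall_mem_of_forall_mkLinearMap_mem {N : Type*} [AddCommGroup N]
    [Module (Localization T) N]
    (g : LocalizedModule T M →ₗ[Localization T] N) (W : Submodule (Localization T) N)
    (hg : ∀ m, g (LocalizedModule.mkLinearMap T M m) ∈ W) (y) : g y ∈ W := by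
  induction y using LocalizedModule.induction_on with
  | h m u =>
    have : LocalizedModule.mk m u =
        Localization.mk 1 u • LocalizedModule.mkLinearMap T M m := by
      rw [LocalizedModule.mkLinearMap_apply, LocalizedModule.mk_smul_mk, one_smul, mul_one]
    rw [this, map_smul]
    exact W.smul_mem _ (hg m)

end LocToLoc

section Patching

variable {A : Type*} [CommRing A] [IsNoetherianRing A]

theorem exists_linearEquiv_of_localizedModule {s t : A} (hst : IsCoprime s t) {T : Submonoid A}
    (h₁ : Submonoid.powers s ≤ T) (h₂ : Submonoid.powers t ≤ T)
    (hT : T ≤ Submonoid.powers s ⊔ Submonoid.powers t) (I : Ideal A)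
    (h : Localization T →+* (Localization T)[X]) (hev : ∀ c, (h c).eval 1 = c)
    (hc0 : ∀ c ∈ I.map (algebraMap A (Localization T)), (h c).coeff 0 = 0)
    (hci : ∀ c i, (h c).coeff (i + 1) ∈ I.map (algebraMap A (Localization T)))
    {M M' : Type*} [AddCommGroup M] [Module A M] [Module.Finite A M]
    [AddCommGroup M'] [Module A M']
    (σ₁ : LocalizedModule (Submonoid.powers s) M ≃ₗ[A] LocalizedModule (Submonoid.powers s) M')
    (σ₂ : LocalizedModule (Submonoid.powers t) M ≃ₗ[A] LocalizedModule (Submonoid.powers t) M')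
    (hcomp : ∀ m : M,
      locToLoc h₁ M' (σ₁ (LocalizedModule.mkLinearMap _ M m)) -
        locToLoc h₂ M' (σ₂ (LocalizedModule.mkLinearMap _ M m)) ∈
        I.map (algebraMap A (Localization T)) •
          (⊤ : Submodule (Localization T) (LocalizedModule T M')))
    [Module.Free (Localization T) (LocalizedModule T M)] :
    ∃ σ : M ≃ₗ[A] M',
      (∀ m, LocalizedModule.mkLinearMap (Submonoid.powers s) M' (σ m) -
        σ₁ (LocalizedModule.mkLinearMap _ M m) ∈
          I • (⊤ : Submodule A (LocalizedModule (Submonoid.powers s) M'))) ∧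
      ∀ m, LocalizedModule.mkLinearMap (Submonoid.powers t) M' (σ m) -
        σ₂ (LocalizedModule.mkLinearMap _ M m) ∈
          I • (⊤ : Submodule A (LocalizedModule (Submonoid.powers t) M')) := by
  obtain ⟨e₁, he₁⟩ := exists_locToLoc_linearEquiv h₁ σ₁
  obtain ⟨e₂, he₂⟩ := exists_locToLoc_linearEquiv h₂ σ₂
  have hdiff : ∀ y, (e₁.toLinearMap - e₂.toLinearMap) y ∈
      I.map (algebraMap A (Localization T)) •
        (⊤ : Submodule (Localization T) (LocalizedModule T M')) := by
    refine forall_mem_of_forall_mkLinearMap_mem _ _ fun m => ?_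
    have := hcomp m
    rw [← he₁, ← he₂, locToLoc_mkLinearMap, locToLoc_mkLinearMap] at this
    exact this
  obtain ⟨n, a, b, ha, hb, hab, hba, hα⟩ := exists_polynomial_family
    (I.map (algebraMap A (Localization T))) h hev hc0 hci (e₁.trans e₂.symm)
    (fun y => by
      have := e₂.symm.toLinearMap.map_mem_smul_top (hdiff y)
      rw [LinearMap.sub_apply, map_sub] at this
      simpa only [LinearEquiv.coe_coe, LinearEquiv.symm_apply_apply, LinearEquiv.trans_apply] using this)
  have hsmul : ∀ (r : A) (i : ℕ) (g : Module.End (Localization T) (LocalizedModule T M)),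
      algebraMap A (Localization T) r ^ (i + 1) • g = r ^ (i + 1) • g := fun r i g => by
    rw [← map_pow, algebraMap_smul]
  exact exists_linearEquiv_of_polynomial_family (L := Localization T)
    (LocalizedModule.mkLinearMap (Submonoid.powers s) M)
    (LocalizedModule.mkLinearMap (Submonoid.powers t) M)
    (LocalizedModule.mkLinearMap T M)
    (LocalizedModule.mkLinearMap (Submonoid.powers s) M')
    (LocalizedModule.mkLinearMap (Submonoid.powers t) M')
    (LocalizedModule.mkLinearMap T M') hst (h₁ (Submonoid.mem_powers s))
    (h₂ (Submonoid.mem_powers t)) hT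
    (locToLoc_mkLinearMap h₁) (locToLoc_mkLinearMap h₂)
    (locToLoc_mkLinearMap h₁) (locToLoc_mkLinearMap h₂)
    σ₁ σ₂ e₁ e₂ he₁ he₂ I n a b ha hb
    (fun r => by simpa only [hsmul] using hab (algebraMap A _ r))
    (fun r => by simpa only [hsmul] using hba (algebraMap A _ r)) hα

end Patching

theorem stmt_11 {R : Type*} [CommRing R] [IsNoetherianRing R] (d : ℕ) (hd : 1 ≤ d)
    (hdim : ringKrullDim R = (d : ℕ))
    (A : Subalgebra R (Polynomial R)) (hA : IsGeometricSubring A d)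
    (s t : R) (hst : Ideal.span {s, t} = (⊤ : Ideal R))
    (hAs : ∀ f : Polynomial R, ∃ k : ℕ, (C s) ^ k * f ∈ A)
    (M M' : Type v) [AddCommGroup M] [Module A M] [Module.Finite A M]
    [AddCommGroup M'] [Module A M'] [Module.Finite A M']
    (σ₁ : LocalizedModule (Submonoid.powers (algebraMap R A s)) M ≃ₗ[Localization (Submonoid.powers (algebraMap R A s))]
      LocalizedModule (Submonoid.powers (algebraMap R A s)) M')
    (σ₂ : LocalizedModule (Submonoid.powers (algebraMap R A t)) M ≃ₗ[Localization (Submonoid.powers (algebraMap R A t))]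
      LocalizedModule (Submonoid.powers (algebraMap R A t)) M')
    -- (1) : `(σ₁)_t ⊗ (A/I_A)_st = (σ₂)_s ⊗ (A/I_A)_st`
    (hcomp : ∀ m : M,
      locToLoc (le_sup_left : Submonoid.powers (algebraMap R A s) ≤
          Submonoid.powers (algebraMap R A s) ⊔ Submonoid.powers (algebraMap R A t)) M'
          (σ₁ (LocalizedModule.mkLinearMap (Submonoid.powers (algebraMap R A s)) M m)) -
        locToLoc (le_sup_right : Submonoid.powers (algebraMap R A t) ≤
          Submonoid.powers (algebraMap R A s) ⊔ Submonoid.powers (algebraMap R A t)) M'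
          (σ₂ (LocalizedModule.mkLinearMap (Submonoid.powers (algebraMap R A t)) M m)) ∈
        ((idealIA A).map (algebraMap A (Localization
            (Submonoid.powers (algebraMap R A s) ⊔ Submonoid.powers (algebraMap R A t))))) •
          (⊤ : Submodule (Localization
            (Submonoid.powers (algebraMap R A s) ⊔ Submonoid.powers (algebraMap R A t)))
            (LocalizedModule
              (Submonoid.powers (algebraMap R A s) ⊔ Submonoid.powers (algebraMap R A t)) M')))
    -- (2) : `M_st` is free
    (hfree : Module.Free (Localization
        (Submonoid.powers (algebraMap R A s) ⊔ Submonoid.powers (algebraMap R A t)))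
      (LocalizedModule
        (Submonoid.powers (algebraMap R A s) ⊔ Submonoid.powers (algebraMap R A t)) M)) :
    ∃ σ : M ≃ₗ[A] M',
      (∀ m : M,
        LocalizedModule.mkLinearMap (Submonoid.powers (algebraMap R A s)) M' (σ m) -
          σ₁ (LocalizedModule.mkLinearMap (Submonoid.powers (algebraMap R A s)) M m) ∈
        ((idealIA A).map (algebraMap A (Localization (Submonoid.powers (algebraMap R A s))))) •
          (⊤ : Submodule (Localization (Submonoid.powers (algebraMap R A s)))
            (LocalizedModule (Submonoid.powers (algebraMap R A s)) M'))) ∧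
      (∀ m : M,
        LocalizedModule.mkLinearMap (Submonoid.powers (algebraMap R A t)) M' (σ m) -
          σ₂ (LocalizedModule.mkLinearMap (Submonoid.powers (algebraMap R A t)) M m) ∈
        ((idealIA A).map (algebraMap A (Localization (Submonoid.powers (algebraMap R A t))))) •
          (⊤ : Submodule (Localization (Submonoid.powers (algebraMap R A t)))
            (LocalizedModule (Submonoid.powers (algebraMap R A t)) M'))) := by
  have : IsNoetherianRing A := hA.1
  have hcop : IsCoprime (algebraMap R A s) (algebraMap R A t) := by
    obtain ⟨x, y, hxy⟩ := Ideal.mem_span_pair.1 (hst ▸ Submodule.mem_top : (1 : R) ∈ _)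
    exact IsCoprime.map (x := s) (y := t) ⟨x, y, hxy⟩ (algebraMap R A)
  have hTR : ∀ u ∈ Submonoid.powers (algebraMap R A s) ⊔ Submonoid.powers (algebraMap R A t),
      ∃ r : R, algebraMap R A r = u := by
    intro u hu
    obtain ⟨a, b, hab⟩ := exists_pow_mul_pow_eq le_rfl ⟨u, hu⟩
    exact ⟨s ^ a * t ^ b, by rw [map_mul, map_pow, map_pow]; exact hab.symm⟩
  obtain ⟨h, hev, hc0, hci⟩ := exists_scaling_hom A
    (Localization (Submonoid.powers (algebraMap R A s) ⊔ Submonoid.powers (algebraMap R A t)))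
    hAs ((le_sup_left : Submonoid.powers (algebraMap R A s) ≤ _) (Submonoid.mem_powers _)) hTR
  obtain ⟨σ, hσ₁, hσ₂⟩ := exists_linearEquiv_of_localizedModule hcop le_sup_left le_sup_right
    le_rfl (idealIA A) h hev hc0 hci (σ₁.restrictScalars A) (σ₂.restrictScalars A) hcomp
  exact ⟨σ, fun m => mem_map_smul_top_of_mem _ (hσ₁ m),
    fun m => mem_map_smul_top_of_mem _ (hσ₂ m)⟩
end

section
/- Let R be a commutative Noetherian ring and M a finitely generated R-module. Let M_tor = { m ∈ M : sm = 0 for some non-zero divisor s ∈ R } be the torsion submodule of M, and set M' = M/M_tor. If M' has a basic element, then M has a basic element. -/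
/-- `x` is a basic element of `M` at the prime `p`. -/
def IsBasicAt {R M : Type*} [CommRing R] [AddCommGroup M] [Module R M]
    (x : M) (p : Ideal R) (hp : p.IsPrime) : Prop :=
  letI := hp
  LocalizedModule.mkLinearMap p.primeCompl M x ∉
    (p.map (algebraMap R (Localization p.primeCompl))) •
      (⊤ : Submodule (Localization p.primeCompl) (LocalizedModule p.primeCompl M))

/-- An element is basic at `p` if its image under some linear map is. -/
theorem IsBasicAt.of_map {R M N : Type*} [CommRing R] [AddCommGroup M] [Module R M]
    [AddCommGroup N] [Module R N] (f : M →ₗ[R] N) {x : M} {p : Ideal R} {hp : p.IsPrime}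
    (h : IsBasicAt (f x) p hp) : IsBasicAt x p hp := by
  intro hx
  apply h
  have hfx := Submodule.smul_top_le_comap_smul_top _ (LocalizedModule.map p.primeCompl f) hx
  simpa [LocalizedModule.map_mk, LocalizedModule.mkLinearMap_apply] using hfx

theorem stmt_12 {R : Type*} [CommRing R] [IsNoetherianRing R]
    (M : Type*) [AddCommGroup M] [Module R M] [Module.Finite R M]
    (h : ∃ x : M ⧸ Submodule.torsion R M,
      ∀ (p : Ideal R) (hp : p.IsPrime), IsBasicAt x p hp) :
    ∃ x : M, ∀ (p : Ideal R) (hp : p.IsPrime), IsBasicAt x p hp := by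
  obtain ⟨x, hx⟩ := h
  obtain ⟨y, rfl⟩ := Submodule.mkQ_surjective _ x
  exact ⟨y, fun p hp ↦ (hx p hp).of_map⟩
end

section
/- Let B ⊆ C be commutative Noetherian rings with dim(B) = dim(C) = d, and suppose there exists an element x ∈ B such that B_x = C_x. Then: (1) for every b ∈ B, the inclusion B ⊆ C induces an equality B/((1 + xb)B) = C/((1 + xb)C) (i.e., an isomorphism of quotient rings); and (2) if a ⊆ C is an ideal with height(a) ≥ d and a + xC = C, then there exists b ∈ B with 1 + xb ∈ a. -/
/-- The height of an ideal: the infimum of the heights (dimensions of the localizations) of the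
primes containing it. -/
noncomputable def idealHeight {R : Type*} [CommRing R] (I : Ideal R) : WithBot (WithTop ℕ) :=
  sInf {h : WithBot (WithTop ℕ) | ∃ (p : Ideal R) (hp : p.IsPrime), I ≤ p ∧
    h = ringKrullDim (Localization (@Ideal.primeCompl R _ p hp))}

/-- If `B → C` becomes surjective after inverting `x`, then for an inclusion of ideals `P ≤ Q` of `C`
with `P` prime not containing `x`, equality may be tested after contraction to `B`. -/
theorem le_of_comap_le_of_away {B C : Type*} [CommRing B] [CommRing C] [Algebra B C] {x : B}
    (hx : ∀ c : C, ∃ (k : ℕ) (b : B), (algebraMap B C x) ^ k * c = algebraMap B C b)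
    {P Q : Ideal C} [P.IsPrime] (hxP : algebraMap B C x ∉ P)
    (h : Q.comap (algebraMap B C) ≤ P.comap (algebraMap B C)) : Q ≤ P := by
  intro c hc
  obtain ⟨k, b, hb⟩ := hx c
  have h1 : algebraMap B C b ∈ P := h (by
    rw [Ideal.mem_comap, ← hb]
    exact Q.mul_mem_left _ hc)
  rw [← hb] at h1
  exact (Ideal.IsPrime.mem_or_mem ‹_› h1).resolve_left
    fun h2 => hxP (Ideal.IsPrime.mem_of_pow_mem ‹_› _ h2)

/-- If `B → C` becomes surjective after inverting `x`, then contracting a prime of `C` not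
containing `x` does not decrease its height. -/
theorem height_le_height_comap_of_away {B C : Type*} [CommRing B] [CommRing C] [Algebra B C] {x : B}
    (hx : ∀ c : C, ∃ (k : ℕ) (b : B), (algebraMap B C x) ^ k * c = algebraMap B C b)
    (P : PrimeSpectrum C) (hxP : algebraMap B C x ∉ P.asIdeal) :
    Order.height P ≤ Order.height (PrimeSpectrum.comap (algebraMap B C) P) := by
  have hmono : Monotone (PrimeSpectrum.comap (algebraMap B C)) := fun _ _ h => Ideal.comap_mono h
  let f : Set.Iic P → Set.Iic (PrimeSpectrum.comap (algebraMap B C) P) :=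
    fun p => ⟨PrimeSpectrum.comap (algebraMap B C) p, hmono p.2⟩
  have hf : StrictMono f := by
    refine Monotone.strictMono_of_injective (fun p q h => hmono h) fun p q h => ?_
    have h' : p.1.asIdeal.comap (algebraMap B C) = q.1.asIdeal.comap (algebraMap B C) :=
      congrArg (fun r => r.1.asIdeal) h
    exact Subtype.ext (PrimeSpectrum.ext (le_antisymm
      (le_of_comap_le_of_away hx (fun h => hxP (q.2 h)) h'.le)
      (le_of_comap_le_of_away hx (fun h => hxP (p.2 h)) h'.ge)))
  have := Order.krullDim_le_of_strictMono f hf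
  rwa [← Order.height_eq_krullDim_Iic, ← Order.height_eq_krullDim_Iic, WithBot.coe_le_coe] at this

/-- The height of an ideal is at most that of every prime containing it. -/
theorem idealHeight_le_height {R : Type*} [CommRing R] {I : Ideal R} (P : PrimeSpectrum R)
    (h : I ≤ P.asIdeal) : idealHeight I ≤ (Order.height P : WithBot ℕ∞) := by
  have h1 : idealHeight I ≤ ringKrullDim (Localization P.asIdeal.primeCompl) :=
    sInf_le ⟨P.asIdeal, P.isPrime, h, rfl⟩
  rwa [IsLocalization.AtPrime.ringKrullDim_eq_height P.asIdeal, P.height_eq_orderHeight] at h1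

/-- A prime whose height is at least the finite Krull dimension is maximal. -/
theorem eq_of_le_of_ringKrullDim_le_height {R : Type*} [CommRing R] {d : ℕ}
    (hd : ringKrullDim R = d) {p q : PrimeSpectrum R} (hp : (d : ℕ∞) ≤ Order.height p)
    (hpq : p ≤ q) : p = q := by
  by_contra hne
  have h1 := Order.height_add_one_le (lt_of_le_of_ne hpq hne)
  have h2 : (Order.height q : WithBot ℕ∞) ≤ d := hd ▸ Order.height_le_krullDim q
  have h3 : Order.height q ≤ (d : ℕ∞) := by exact_mod_cast h2
  have h4 : ((d + 1 : ℕ) : ℕ∞) ≤ d := by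
    push_cast
    exact ((add_le_add_left hp 1).trans h1).trans h3
  exact absurd (Nat.cast_le.mp h4) (by omega)

/-- An ideal comaximal with `x` contracts to an ideal comaximal with `x`, when `B ⊆ C` is an
equality after inverting `x` and the ideal has height at least `dim B`. -/
theorem comap_sup_span_eq_top_of_away {B C : Type*} [CommRing B] [CommRing C] [Algebra B C] {d : ℕ}
    (hdB : ringKrullDim B = d) {x : B}
    (hx : ∀ c : C, ∃ (k : ℕ) (b : B), (algebraMap B C x) ^ k * c = algebraMap B C b)
    {a : Ideal C} (ha : (d : WithBot ℕ∞) ≤ idealHeight a)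
    (hax : a ⊔ Ideal.span {algebraMap B C x} = ⊤) :
    a.comap (algebraMap B C) ⊔ Ideal.span {x} = ⊤ := by
  by_contra hne
  obtain ⟨n, hn, hle⟩ := Ideal.exists_le_maximal _ hne
  have hnp := hn.isPrime
  obtain ⟨q, hq, hqn⟩ := Ideal.exists_minimalPrimes_le (le_sup_left.trans hle)
  obtain ⟨P, hP, haP, rfl⟩ := Ideal.exists_comap_eq_of_mem_minimalPrimes (algebraMap B C) q hq
  have hxP : algebraMap B C x ∉ P := fun h => hP.ne_top <| top_le_iff.mp <|
    hax ▸ sup_le haP ((Ideal.span_singleton_le_iff_mem _).mpr h)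
  have h1 : (d : ℕ∞) ≤ Order.height (⟨P, hP⟩ : PrimeSpectrum C) := by
    have := ha.trans (idealHeight_le_height ⟨P, hP⟩ haP)
    exact_mod_cast this
  have h2 := eq_of_le_of_ringKrullDim_le_height hdB
    (h1.trans (height_le_height_comap_of_away hx ⟨P, hP⟩ hxP)) (q := ⟨n, hnp⟩) hqn
  have h3 : P.comap (algebraMap B C) = n := congrArg PrimeSpectrum.asIdeal h2
  have h4 : x ∈ n := (le_sup_right.trans hle) (Ideal.mem_span_singleton_self x)
  rw [← h3] at h4
  exact hxP h4

/-- `x ^ k` has inverse `(-b) ^ k` modulo `1 + x * b`. -/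
theorem one_add_mul_dvd_neg_pow_mul_pow_sub_one {R : Type*} [CommRing R] (x b : R) (k : ℕ) :
    1 + x * b ∣ (-b) ^ k * x ^ k - 1 := by
  rw [← mul_pow, ← neg_dvd]
  convert sub_one_dvd_pow_sub_one (-b * x) k using 1
  ring

/-- If `B ⊆ C` is an equality after inverting `x`, then it is an equality modulo `1 + x * b`. -/
theorem quotientMap_one_add_mul_bijective {B C : Type*} [CommRing B] [CommRing C] [Algebra B C]
    (hinj : Function.Injective (algebraMap B C)) {x : B}
    (hx : ∀ c : C, ∃ (k : ℕ) (b : B), (algebraMap B C x) ^ k * c = algebraMap B C b) (b : B)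
    (h : Ideal.span {1 + x * b} ≤
      (Ideal.span {algebraMap B C (1 + x * b)}).comap (algebraMap B C)) :
    Function.Bijective (Ideal.quotientMap (Ideal.span {algebraMap B C (1 + x * b)})
      (algebraMap B C) h) := by
  constructor
  · apply Ideal.quotientMap_injective'
    intro y hy
    obtain ⟨c, hc⟩ := Ideal.mem_span_singleton.mp hy
    obtain ⟨k, b', hb'⟩ := hx c
    have h1 : x ^ k * y = (1 + x * b) * b' := hinj (by
      rw [map_mul, map_mul, map_pow, hc, ← hb']
      ring)
    obtain ⟨e, he⟩ := one_add_mul_dvd_neg_pow_mul_pow_sub_one x b k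
    exact Ideal.mem_span_singleton.mpr ⟨(-b) ^ k * b' - e * y, by
      linear_combination (-y) * he + (-b) ^ k * h1⟩
  · intro c
    obtain ⟨c, rfl⟩ := Ideal.Quotient.mk_surjective c
    obtain ⟨k, b', hb'⟩ := hx c
    obtain ⟨e, he⟩ := one_add_mul_dvd_neg_pow_mul_pow_sub_one x b k
    refine ⟨Ideal.Quotient.mk _ ((-b) ^ k * b'), ?_⟩
    rw [Ideal.quotientMap_mk, Ideal.Quotient.eq, Ideal.mem_span_singleton]
    refine ⟨algebraMap B C e * c, ?_⟩
    have he' := congrArg (algebraMap B C) he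
    simp only [map_sub, map_mul, map_pow, map_one] at he' ⊢
    linear_combination c * he' - (algebraMap B C (-b)) ^ k * hb'

theorem stmt_14 {B C : Type*} [CommRing B] [CommRing C]
    [IsNoetherianRing B] [IsNoetherianRing C] [Algebra B C]
    (hinj : Function.Injective (algebraMap B C)) (d : ℕ)
    (hdB : ringKrullDim B = (d : ℕ)) (hdC : ringKrullDim C = (d : ℕ))
    (x : B)
    (hx : ∀ c : C, ∃ (k : ℕ) (b : B), (algebraMap B C x) ^ k * c = algebraMap B C b) :
    (∀ b : B, Function.Bijective
      (Ideal.quotientMap (Ideal.span {algebraMap B C (1 + x * b)}) (algebraMap B C)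
        (by
          rw [Ideal.span_le]
          rintro y rfl
          exact Ideal.mem_comap.mpr (Ideal.subset_span rfl) : Ideal.span {1 + x * b} ≤
            (Ideal.span {algebraMap B C (1 + x * b)}).comap (algebraMap B C)))) ∧
    (∀ a : Ideal C, ((d : ℕ) : WithBot (WithTop ℕ)) ≤ idealHeight a →
      a ⊔ Ideal.span {algebraMap B C x} = ⊤ →
      ∃ b : B, algebraMap B C (1 + x * b) ∈ a) := by
  refine ⟨fun b => quotientMap_one_add_mul_bijective hinj hx b _, fun a ha hax => ?_⟩
  have h := comap_sup_span_eq_top_of_away hdB hx ha hax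
  obtain ⟨y, hy, z, hz, hyz⟩ := Submodule.mem_sup.mp ((Ideal.eq_top_iff_one _).mp h)
  obtain ⟨b, rfl⟩ := Ideal.mem_span_singleton.mp hz
  refine ⟨-b, ?_⟩
  have h1 : 1 + x * -b = y := by linear_combination -hyz
  rw [h1]
  exact hy
end
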